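/- arXiv:1605.01230 — 2 statements merged into one kernel-verified Lean document; each statement's English description precedes it below -/
import Mathlib

section
/- The functor Γ_ℚ, defined on objects by Γ_ℚ(V, u) = [0, u]_V (the unit interval [0,u] of V with x ⊕ y = u ∧ (x+y), x* = u − x, and scalar multiplication by rationals in [0,1] inherited from V) and on arrows by Γ_ℚ(f) = f restricted to [0, u]_V, establishes a categorical equivalence between the category uQVL of ℚ-vector lattices with a distinguished strong unit (with unit-preserving lattice-linear maps) and the category DMV of DMV-algebras (with DMV-algebra homomorphisms). -/
/-- An MV-algebra: an abelian monoid `(A, ⊕, 0)` with an involution `*` satisfying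
the Łukasiewicz axioms. -/
class MVAlgebra (A : Type) where
  oplus : A → A → A
  star : A → A
  zero : A
  oplus_assoc : ∀ x y z : A, oplus (oplus x y) z = oplus x (oplus y z)
  oplus_comm : ∀ x y : A, oplus x y = oplus y x
  oplus_zero : ∀ x : A, oplus x zero = x
  star_star : ∀ x : A, star (star x) = x
  lukasiewicz : ∀ x y : A,
    oplus (star (oplus (star x) y)) y = oplus (star (oplus (star y) x)) x
  oplus_star_zero : ∀ x : A, oplus (star zero) x = star zero

namespace MVAlgebra

variable {A : Type} [MVAlgebra A]

/-- The top element `1 = 0*`. -/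
def one : A := star zero

/-- The MV-product `x ⊙ y = (x* ⊕ y*)*`. -/
def odot (x y : A) : A := star (oplus (star x) (star y))

/-- `n`-fold ⊕-sum of an element. -/
def nmul : ℕ → A → A
  | 0, _ => zero
  | n + 1, x => oplus (nmul n x) x

/-- The lattice join `x ∨ y = (x ⊙ y*) ⊕ y`. -/
def sup (x y : A) : A := oplus (odot x (star y)) y

/-- The lattice meet `x ∧ y = (x ⊕ y*) ⊙ y`. -/
def inf (x y : A) : A := odot (oplus x (star y)) y

/-- The MV-order: `x ≤ y` iff `x ⊙ y* = 0`. -/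
def le (x y : A) : Prop := odot x (star y) = zero

end MVAlgebra

/-- The rational unit interval `[0,1] ∩ ℚ`. -/
def QI : Type := {q : ℚ // 0 ≤ q ∧ q ≤ 1}

namespace QI

/-- Truncated addition on `[0,1] ∩ ℚ`. -/
def oplus (r s : QI) : QI :=
  ⟨min (r.1 + s.1) 1, le_min (add_nonneg r.2.1 s.2.1) zero_le_one, min_le_right _ _⟩

/-- Negation `r* = 1 - r` on `[0,1] ∩ ℚ`. -/
def star (r : QI) : QI :=
  ⟨1 - r.1, by constructor <;> [linarith [r.2.2]; linarith [r.2.1]]⟩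

def zero : QI := ⟨0, le_refl 0, zero_le_one⟩

def one : QI := ⟨1, zero_le_one, le_refl 1⟩

/-- Ordinary multiplication of rationals, restricted to `[0,1] ∩ ℚ`. -/
def mul (r s : QI) : QI :=
  ⟨r.1 * s.1, mul_nonneg r.2.1 s.2.1, by nlinarith [r.2.1, r.2.2, s.2.1, s.2.2]⟩

/-- The MV-product `r ⊙ s = (r* ⊕ s*)*` on `[0,1] ∩ ℚ`. -/
def odot (r s : QI) : QI := star (oplus (star r) (star s))

/-- Division by a natural number in `[0,1] ∩ ℚ`. -/
def div (r : QI) (n : ℕ) : QI :=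
  ⟨r.1 / n, div_nonneg r.2.1 (Nat.cast_nonneg n), by
    rcases Nat.eq_zero_or_pos n with h | h
    · simp [h]
    · exact le_trans (div_le_self r.2.1 (by exact_mod_cast h)) r.2.2⟩

/-- `1/n` as an element of `[0,1] ∩ ℚ` (with `1/0 = 0`). -/
def oneOver (n : ℕ) : QI := div one n

/-- Join (maximum) in `[0,1] ∩ ℚ`. -/
def sup (r s : QI) : QI :=
  ⟨max r.1 s.1, le_max_of_le_left r.2.1, max_le r.2.2 s.2.2⟩

/-- Meet (minimum) in `[0,1] ∩ ℚ`. -/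
def inf (r s : QI) : QI :=
  ⟨min r.1 s.1, le_min r.2.1 s.2.1, min_le_of_left_le r.2.2⟩

end QI

/-- A DMV-algebra: an MV-algebra with division operators `δ_n` (`n ≥ 1`) satisfying
`n·δ_n x = x` and `δ_n x ⊙ (n-1)·δ_n x = 0`. -/
class DMVAlgebra (A : Type) extends MVAlgebra A where
  delta : ℕ → A → A
  delta_nmul : ∀ n : ℕ, 1 ≤ n → ∀ x : A, MVAlgebra.nmul n (delta n x) = x
  delta_odot : ∀ n : ℕ, 1 ≤ n → ∀ x : A,
    MVAlgebra.odot (delta n x) (MVAlgebra.nmul (n - 1) (delta n x)) = MVAlgebra.zero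

/-- Homomorphism of MV-algebras: preserves `⊕`, `*` and `0`. -/
def IsMVHom {A B : Type} [MVAlgebra A] [MVAlgebra B] (f : A → B) : Prop :=
  (∀ x y : A, f (MVAlgebra.oplus x y) = MVAlgebra.oplus (f x) (f y)) ∧
  (∀ x : A, f (MVAlgebra.star x) = MVAlgebra.star (f x)) ∧
  f MVAlgebra.zero = MVAlgebra.zero

/-- Homomorphism of DMV-algebras: an MV-homomorphism preserving every `δ_n`. -/
def IsDMVHom {A B : Type} [DMVAlgebra A] [DMVAlgebra B] (f : A → B) : Prop :=
  IsMVHom f ∧ ∀ n : ℕ, 1 ≤ n → ∀ x : A, f (DMVAlgebra.delta n x) = DMVAlgebra.delta n (f x)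

/-- Ideal of an MV-algebra: contains `0`, downward closed, closed under `⊕`. -/
def IsMVIdeal {A : Type} [MVAlgebra A] (I : Set A) : Prop :=
  MVAlgebra.zero ∈ I ∧ (∀ x ∈ I, ∀ y : A, MVAlgebra.le y x → y ∈ I) ∧
  ∀ x ∈ I, ∀ y ∈ I, MVAlgebra.oplus x y ∈ I

/-- Maximal ideal: a proper ideal maximal under inclusion. -/
def IsMaximalMVIdeal {A : Type} [MVAlgebra A] (I : Set A) : Prop :=
  IsMVIdeal I ∧ I ≠ Set.univ ∧
  ∀ J : Set A, IsMVIdeal J → J ≠ Set.univ → I ⊆ J → J = I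

/-- Semisimplicity: the intersection of all maximal ideals is `{0}`. -/
def IsSemisimple (A : Type) [MVAlgebra A] : Prop :=
  ∀ x : A, (∀ I : Set A, IsMaximalMVIdeal I → x ∈ I) → x = MVAlgebra.zero

/-- Bimorphism `[0,1]_ℚ × A → C`: preserves `∨`, `∧` and the partial sum `+`
in each argument separately. -/
def IsQBimorphism {A C : Type} [MVAlgebra A] [MVAlgebra C] (β : QI → A → C) : Prop :=
  (∀ (r s : QI) (a : A), β (QI.sup r s) a = MVAlgebra.sup (β r a) (β s a)) ∧
  (∀ (r s : QI) (a : A), β (QI.inf r s) a = MVAlgebra.inf (β r a) (β s a)) ∧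
  (∀ (r s : QI) (a : A), QI.odot r s = QI.zero →
    MVAlgebra.odot (β r a) (β s a) = MVAlgebra.zero ∧
      β (QI.oplus r s) a = MVAlgebra.oplus (β r a) (β s a)) ∧
  (∀ (r : QI) (a b : A), β r (MVAlgebra.sup a b) = MVAlgebra.sup (β r a) (β r b)) ∧
  (∀ (r : QI) (a b : A), β r (MVAlgebra.inf a b) = MVAlgebra.inf (β r a) (β r b)) ∧
  (∀ (r : QI) (a b : A), MVAlgebra.odot a b = MVAlgebra.zero →
    MVAlgebra.odot (β r a) (β r b) = MVAlgebra.zero ∧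
      β r (MVAlgebra.oplus a b) = MVAlgebra.oplus (β r a) (β r b))

/-- `T`, together with the bimorphism `β`, is the semisimple tensor product
`[0,1]_ℚ ⊗ A`: `T` is semisimple and `β` is universal among bimorphisms into
semisimple MV-algebras. -/
def IsQTensor (A T : Type) [MVAlgebra A] [MVAlgebra T] (β : QI → A → T) : Prop :=
  IsSemisimple T ∧ IsQBimorphism β ∧
  ∀ (C : Type) [MVAlgebra C], IsSemisimple C → ∀ γ : QI → A → C, IsQBimorphism γ →
    ∃! h : T → C, IsMVHom h ∧ ∀ (r : QI) (a : A), h (β r a) = γ r a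

/-- The DMV-structure of `T` is the canonical one of `[0,1]_ℚ ⊗ A`:
`δ_n (t ⊗ a) = (t/n) ⊗ a`. -/
def DeltaCompat {A T : Type} [MVAlgebra A] [DMVAlgebra T] (β : QI → A → T) : Prop :=
  ∀ n : ℕ, 1 ≤ n → ∀ (t : QI) (a : A),
    DMVAlgebra.delta n (β t a) = β (QI.div t n) a

/-- A ℚ-vector lattice with a distinguished strong unit: a lattice-ordered
vector space over ℚ together with a positive element `unit` such that every
element is dominated by some natural multiple of `unit`. -/
structure UQVL : Type 1 where
  carrier : Type
  [ag : AddCommGroup carrier]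
  [lat : Lattice carrier]
  [cov : CovariantClass carrier carrier (· + ·) (· ≤ ·)]
  [mod : Module ℚ carrier]
  unit : carrier
  unit_nonneg : 0 ≤ unit
  unit_strong : ∀ v : carrier, ∃ m : ℕ, v ≤ m • unit

attribute [instance] UQVL.ag UQVL.lat UQVL.cov UQVL.mod

/-- The unit interval `[0, u]` of a ℚ-vector lattice with strong unit `u`. -/
def UQVL.interval (V : UQVL) : Type := {x : V.carrier // 0 ≤ x ∧ x ≤ V.unit}

/-- A map `h : [0,u]_V → [0,w]_W` is a homomorphism for the induced DMV-algebra
structures: it preserves the truncated addition `x ⊕ y = u ⊓ (x + y)`, the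
involution `x* = u - x`, the bottom element `0`, and each division `δ_n x = x/n`. -/
def IsIntervalDMVHom (V W : UQVL) (h : V.interval → W.interval) : Prop :=
  (∀ x y z : V.interval, z.1 = V.unit ⊓ (x.1 + y.1) →
      (h z).1 = W.unit ⊓ ((h x).1 + (h y).1)) ∧
  (∀ x z : V.interval, z.1 = V.unit - x.1 → (h z).1 = W.unit - (h x).1) ∧
  (∀ z : V.interval, z.1 = 0 → (h z).1 = 0) ∧
  (∀ n : ℕ, 1 ≤ n → ∀ x z : V.interval, z.1 = ((n : ℚ)⁻¹) • x.1 →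
      (h z).1 = ((n : ℚ)⁻¹) • (h x).1)

/-- Arrows of `uQVL`: ℚ-linear lattice homomorphisms preserving the strong unit. -/
def IsUQVLHom (V W : UQVL) (f : V.carrier → W.carrier) : Prop :=
  (∀ x y : V.carrier, f (x + y) = f x + f y) ∧
  (∀ (q : ℚ) (x : V.carrier), f (q • x) = q • f x) ∧
  (∀ x y : V.carrier, f (x ⊓ y) = f x ⊓ f y) ∧
  (∀ x y : V.carrier, f (x ⊔ y) = f x ⊔ f y) ∧
  f V.unit = W.unit


namespace GammaQ

section Lat

variable {G : Type} [AddCommGroup G] [Lattice G]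
  [CovariantClass G G (· + ·) (· ≤ ·)]

theorem nonneg_of_nsmul (n : ℕ) (hn : 0 < n) (y : G) (h : 0 ≤ n • y) : 0 ≤ y := by
  have hne : (Finset.range n).Nonempty := ⟨0, Finset.mem_range.2 hn⟩
  have key : (Finset.range n).inf' hne (fun i => i • y) - y
      ≤ (Finset.range n).inf' hne (fun i => i • y) := by
    refine Finset.le_inf' _ _ fun i hi => ?_
    rw [sub_le_iff_le_add]
    rw [Finset.mem_range] at hi
    have e : i • y + y = (i + 1) • y := (succ_nsmul y i).symm
    rw [e]
    rcases Nat.lt_or_ge (i + 1) n with h1 | h1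
    · exact Finset.inf'_le (fun i => i • y) (Finset.mem_range.2 h1)
    · have : i + 1 = n := by omega
      rw [this]
      refine le_trans (Finset.inf'_le (fun i => i • y) (Finset.mem_range.2 hn)) ?_
      simpa using h
  have := sub_le_self_iff _ |>.1 key
  exact this

theorem eq_zero_of_nsmul (n : ℕ) (hn : 0 < n) (y : G) (h : n • y = 0) : y = 0 := by
  apply le_antisymm
  · have : 0 ≤ -y := nonneg_of_nsmul n hn (-y) (by rw [smul_neg, h, neg_zero])
    exact neg_nonneg.1 this
  · exact nonneg_of_nsmul n hn y h.ge

variable [Module ℚ G]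

theorem smul_nonneg' (q : ℚ) (hq : 0 ≤ q) (x : G) (hx : 0 ≤ x) : 0 ≤ q • x := by
  apply nonneg_of_nsmul q.den q.den_pos
  have : q.den • q • x = q.num.toNat • x := by
    rw [← Nat.cast_smul_eq_nsmul ℚ, ← Nat.cast_smul_eq_nsmul ℚ, smul_smul]
    congr 1
    have h1 : ((q.num.toNat : ℤ) : ℚ) = q.num := by
      rw [Int.toNat_of_nonneg (Rat.num_nonneg.2 hq)]
    have h2 := Rat.den_mul_eq_num q
    rw [h2, ← h1, Int.cast_natCast]
  rw [this]
  exact nsmul_nonneg hx _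

theorem smul_mono' (q : ℚ) (hq : 0 ≤ q) (x y : G) (h : x ≤ y) : q • x ≤ q • y := by
  have := smul_nonneg' q hq (y - x) (sub_nonneg.2 h)
  rw [smul_sub] at this
  exact sub_nonneg.1 this

theorem smul_inf'' (q : ℚ) (hq : 0 < q) (x y : G) : q • (x ⊓ y) = q • x ⊓ q • y := by
  apply le_antisymm
  · exact le_inf (smul_mono' q hq.le _ _ inf_le_left) (smul_mono' q hq.le _ _ inf_le_right)
  · have h1 : q⁻¹ • (q • x ⊓ q • y) ≤ x ⊓ y := by
      refine le_inf ?_ ?_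
      · have := smul_mono' q⁻¹ (inv_nonneg.2 hq.le) _ _ (inf_le_left : q • x ⊓ q • y ≤ q • x)
        rwa [inv_smul_smul₀ hq.ne'] at this
      · have := smul_mono' q⁻¹ (inv_nonneg.2 hq.le) _ _ (inf_le_right : q • x ⊓ q • y ≤ q • y)
        rwa [inv_smul_smul₀ hq.ne'] at this
    have := smul_mono' q hq.le _ _ h1
    rwa [smul_inv_smul₀ hq.ne'] at this

end Lat

theorem part1 (V W : UQVL) (f : V.carrier → W.carrier) (hf : IsUQVLHom V W f)
    (x : V.interval) : 0 ≤ f x.1 ∧ f x.1 ≤ W.unit := by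
  obtain ⟨h1, h2, h3, h4, h5⟩ := hf
  have h0 : f 0 = 0 := by simpa using h2 0 0
  constructor
  · have := h3 0 x.1
    rw [inf_eq_left.2 x.2.1, h0] at this
    exact inf_eq_left.1 this.symm
  · have := h3 x.1 V.unit
    rw [inf_eq_left.2 x.2.2, h5] at this
    exact inf_eq_left.1 this.symm

section Ext

variable {V W : UQVL} {h : V.interval → W.interval}

theorem hmono (hh : IsIntervalDMVHom V W h) (x y : V.interval) (hxy : x.1 ≤ y.1) : (h x).1 ≤ (h y).1 := by
  have hd : 0 ≤ y.1 - x.1 ∧ y.1 - x.1 ≤ V.unit :=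
    ⟨sub_nonneg.2 hxy, (sub_le_self _ x.2.1).trans y.2.2⟩
  have := hh.1 x ⟨y.1 - x.1, hd⟩ y (by simp [y.2.2])
  rw [this]
  exact le_inf (h x).2.2 (le_add_of_nonneg_right (h _).2.1)

theorem hadd (hh : IsIntervalDMVHom V W h) (x y z : V.interval) (hz : z.1 = x.1 + y.1) : (h z).1 = (h x).1 + (h y).1 := by
  have e := hh.1 x y z (by rw [← hz, inf_eq_right.2 z.2.2])
  rw [e, inf_eq_right]
  have hs : 0 ≤ V.unit - x.1 ∧ V.unit - x.1 ≤ V.unit :=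
    ⟨sub_nonneg.2 x.2.2, sub_le_self _ x.2.1⟩
  have h1 := hh.2.1 x ⟨_, hs⟩ rfl
  have h2 := hmono hh y ⟨_, hs⟩ (by
    show y.1 ≤ V.unit - x.1
    rw [le_sub_iff_add_le']
    exact hz ▸ z.2.2)
  rw [h1, le_sub_iff_add_le'] at h2
  exact h2

theorem hinf (hh : IsIntervalDMVHom V W h) (x y z : V.interval) (hz : z.1 = x.1 ⊓ y.1) : (h z).1 = (h x).1 ⊓ (h y).1 := by
  have hs : 0 ≤ V.unit - y.1 ∧ V.unit - y.1 ≤ V.unit :=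
    ⟨sub_nonneg.2 y.2.2, sub_le_self _ y.2.1⟩
  have h1 := hh.2.1 y ⟨_, hs⟩ rfl
  have e : V.unit ⊓ (x.1 + (V.unit - y.1)) = z.1 + (V.unit - y.1) := by
    rw [hz, inf_add, add_sub_cancel, inf_comm]
  have ht : 0 ≤ V.unit ⊓ (x.1 + (V.unit - y.1)) ∧ V.unit ⊓ (x.1 + (V.unit - y.1)) ≤ V.unit :=
    ⟨le_inf V.unit_nonneg (add_nonneg x.2.1 hs.1), inf_le_left⟩
  have h2 := hh.1 x ⟨_, hs⟩ ⟨_, ht⟩ rfl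
  have h3 := hadd hh z ⟨_, hs⟩ ⟨_, ht⟩ e
  rw [h3, h1] at h2
  have h4 : (h x).1 ⊓ (h y).1 + (W.unit - (h y).1) = W.unit ⊓ ((h x).1 + (W.unit - (h y).1)) := by
    rw [inf_add, add_sub_cancel, inf_comm]
  rw [← h4] at h2
  exact add_right_cancel h2

theorem hsmul (hh : IsIntervalDMVHom V W h) (n : ℕ) (hn : 0 < n) (x z : V.interval) (hz : (n : ℚ) • z.1 = x.1) :
    (n : ℚ) • (h z).1 = (h x).1 := by
  have hn' : (n : ℚ) ≠ 0 := by positivity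
  have := hh.2.2.2 n hn x z (by rw [← hz, inv_smul_smul₀ hn'])
  rw [this, smul_inv_smul₀ hn']

theorem hunit (hh : IsIntervalDMVHom V W h) (z : V.interval) (hz : z.1 = V.unit) : (h z).1 = W.unit := by
  have h0 := hh.2.2.1 ⟨0, le_rfl, V.unit_nonneg⟩ rfl
  have := hh.2.1 ⟨0, le_rfl, V.unit_nonneg⟩ z (by simpa using hz)
  rw [this, h0, sub_zero]

end Ext

theorem exists_div {V : UQVL} (n : ℕ) (hn : 0 < n) (x : V.interval) :
    ∃ z : V.interval, (n : ℚ) • z.1 = x.1 := by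
  have hn' : (n : ℚ) ≠ 0 := by positivity
  have h0 : 0 ≤ (n : ℚ)⁻¹ • x.1 := smul_nonneg' _ (by positivity) _ x.2.1
  refine ⟨⟨(n : ℚ)⁻¹ • x.1, h0, ?_⟩, smul_inv_smul₀ hn' _⟩
  refine le_trans ?_ x.2.2
  have h1 : (n : ℚ)⁻¹ • x.1 ≤ n • ((n : ℚ)⁻¹ • x.1) := le_self_nsmul h0 hn.ne'
  rwa [← Nat.cast_smul_eq_nsmul ℚ, smul_inv_smul₀ hn'] at h1

/-- The graph of the extension of `h`. -/
def Rel {V W : UQVL} (h : V.interval → W.interval) (v : V.carrier) (z : W.carrier) : Prop :=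
  ∃ (n : ℕ) (_ : 0 < n) (a b : V.interval), v = (n : ℚ) • (a.1 - b.1) ∧
    z = (n : ℚ) • ((h a).1 - (h b).1)

section Ext

variable {V W : UQVL} {h : V.interval → W.interval}

/-- Halved sums exist: `a/(2m) + d/(2n)`. -/
theorem exists_comb (n m : ℕ) (hn : 0 < n) (hm : 0 < m) (a d : V.interval)
    (hh : IsIntervalDMVHom V W h) :
    ∃ z : V.interval, ((2 * n * m : ℕ) : ℚ) • z.1 = (n : ℚ) • a.1 + (m : ℚ) • d.1 ∧
      ((2 * n * m : ℕ) : ℚ) • (h z).1 = (n : ℚ) • (h a).1 + (m : ℚ) • (h d).1 := by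
  obtain ⟨a', ha'⟩ := exists_div (2 * m) (by positivity) a
  obtain ⟨d', hd'⟩ := exists_div (2 * n) (by positivity) d
  have ha2 : (2 : ℚ) • a'.1 ≤ V.unit := by
    refine le_trans ?_ a.2.2
    rw [← ha', Nat.cast_mul, mul_comm, mul_smul]
    have : 0 ≤ ((2 : ℕ) : ℚ) • a'.1 := smul_nonneg' _ (by positivity) _ a'.2.1
    have := le_self_nsmul this hm.ne'
    rwa [← Nat.cast_smul_eq_nsmul ℚ] at this
  have hd2 : (2 : ℚ) • d'.1 ≤ V.unit := by
    refine le_trans ?_ d.2.2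
    rw [← hd', Nat.cast_mul, mul_comm, mul_smul]
    have : 0 ≤ ((2 : ℕ) : ℚ) • d'.1 := smul_nonneg' _ (by positivity) _ d'.2.1
    have := le_self_nsmul this hn.ne'
    rwa [← Nat.cast_smul_eq_nsmul ℚ] at this
  have hs : a'.1 + d'.1 ≤ V.unit := by
    have := smul_mono' (1/2 : ℚ) (by norm_num) _ _ (add_le_add ha2 hd2)
    have e1 : (1/2 : ℚ) • ((2 : ℚ) • a'.1 + (2 : ℚ) • d'.1) = a'.1 + d'.1 := by module
    have e2 : (1/2 : ℚ) • (V.unit + V.unit) = V.unit := by module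
    rwa [e1, e2] at this
  refine ⟨⟨a'.1 + d'.1, add_nonneg a'.2.1 d'.2.1, hs⟩, ?_, ?_⟩
  · rw [← ha', ← hd']; push_cast; module
  · rw [hadd hh a' d' ⟨a'.1 + d'.1, add_nonneg a'.2.1 d'.2.1, hs⟩ rfl, ← hsmul hh _ (by positivity) a a' ha',
      ← hsmul hh _ (by positivity) d d' hd']; push_cast; module

theorem rel_unique (hh : IsIntervalDMVHom V W h) {v : V.carrier} {z z' : W.carrier}
    (h1 : Rel h v z) (h2 : Rel h v z') : z = z' := by
  obtain ⟨n, hn, a, b, hv, rfl⟩ := h1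
  obtain ⟨m, hm, c, d, hv', rfl⟩ := h2
  obtain ⟨p, hp, hp'⟩ := exists_comb n m hn hm a d hh
  obtain ⟨q, hq, hq'⟩ := exists_comb n m hn hm b c hh
  have hN : ((2 * n * m : ℕ) : ℚ) ≠ 0 := by positivity
  have e : p = q := by
    apply Subtype.ext
    apply smul_right_injective V.carrier hN
    show ((2 * n * m : ℕ) : ℚ) • p.1 = ((2 * n * m : ℕ) : ℚ) • q.1
    rw [hp, hq]
    have := hv.symm.trans hv'
    rw [smul_sub, smul_sub, sub_eq_sub_iff_add_eq_add] at this
    rw [this, add_comm]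
  rw [e, hq'] at hp'
  rw [smul_sub, smul_sub, sub_eq_sub_iff_add_eq_add, ← hp', add_comm]

theorem rel_add (hh : IsIntervalDMVHom V W h) {v v' : V.carrier} {z z' : W.carrier}
    (h1 : Rel h v z) (h2 : Rel h v' z') : Rel h (v + v') (z + z') := by
  obtain ⟨n, hn, a, b, rfl, rfl⟩ := h1
  obtain ⟨m, hm, c, d, rfl, rfl⟩ := h2
  obtain ⟨p, hp, hp'⟩ := exists_comb n m hn hm a c hh
  obtain ⟨q, hq, hq'⟩ := exists_comb n m hn hm b d hh
  refine ⟨2 * n * m, by positivity, p, q, ?_, ?_⟩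
  · rw [smul_sub _ p.1, hp, hq]; module
  · rw [smul_sub _ (h p).1, hp', hq']; module

/-- Normal form of a pair of elements with a common shift. -/
theorem exists_shift (x : V.carrier) : ∃ N : ℕ, ∀ n : ℕ, N ≤ n → 0 < n →
    ∃ a : V.interval, x = ((2 * n : ℕ) : ℚ) • a.1 - (n : ℚ) • V.unit := by
  obtain ⟨m1, h1⟩ := V.unit_strong x
  obtain ⟨m2, h2⟩ := V.unit_strong (-x)
  refine ⟨max m1 m2, fun n hn hpos => ?_⟩
  have e1 : x ≤ (n : ℚ) • V.unit := by
    rw [Nat.cast_smul_eq_nsmul]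
    exact h1.trans (nsmul_le_nsmul_left V.unit_nonneg ((le_max_left _ _).trans hn))
  have e2 : -x ≤ (n : ℚ) • V.unit := by
    rw [Nat.cast_smul_eq_nsmul]
    exact h2.trans (nsmul_le_nsmul_left V.unit_nonneg ((le_max_right _ _).trans hn))
  have hn' : (n : ℚ) ≠ 0 := by positivity
  refine ⟨⟨((2 * n : ℕ) : ℚ)⁻¹ • (x + (n : ℚ) • V.unit), smul_nonneg' _ (by positivity) _ ?_, ?_⟩, ?_⟩
  · exact neg_le_iff_add_nonneg'.1 e2
  · have := smul_mono' ((2 * n : ℕ) : ℚ)⁻¹ (by positivity) _ _ (add_le_add_left e1 ((n : ℚ) • V.unit))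
    refine this.trans (le_of_eq ?_)
    rw [← add_smul, smul_smul]
    push_cast
    rw [show ((2 * (n:ℚ))⁻¹ * ((n:ℚ) + n)) = 1 by field_simp; norm_num, one_smul]
  · show x = ((2 * n : ℕ) : ℚ) • ((2 * n : ℕ) : ℚ)⁻¹ • (x + (n : ℚ) • V.unit) - (n : ℚ) • V.unit
    rw [smul_inv_smul₀ (by positivity)]
    simp

theorem rel_shift (hh : IsIntervalDMVHom V W h) (n : ℕ) (hn : 0 < n) (a : V.interval) :
    Rel h (((2 * n : ℕ) : ℚ) • a.1 - (n : ℚ) • V.unit)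
      (((2 * n : ℕ) : ℚ) • (h a).1 - (n : ℚ) • W.unit) := by
  obtain ⟨d, hd⟩ := exists_div 2 (by norm_num) (⟨V.unit, V.unit_nonneg, le_rfl⟩ : V.interval)
  have h2 := hsmul hh 2 (by norm_num) _ d hd
  rw [hunit hh ⟨V.unit, V.unit_nonneg, le_rfl⟩ rfl] at h2
  refine ⟨2 * n, by positivity, a, d, ?_, ?_⟩
  · rw [smul_sub]
    congr 1
    refine (congrArg (fun t => (n : ℚ) • t) hd).symm.trans ?_
    show (n : ℚ) • ((2 : ℕ) : ℚ) • d.1 = _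
    push_cast; module
  · rw [smul_sub]
    congr 1
    refine (congrArg (fun t => (n : ℚ) • t) h2).symm.trans ?_
    show (n : ℚ) • ((2 : ℕ) : ℚ) • (h d).1 = _
    push_cast; module

theorem part2 (V W : UQVL) (h : V.interval → W.interval) (hh : IsIntervalDMVHom V W h) :
    ∃! f : V.carrier → W.carrier,
        IsUQVLHom V W f ∧ ∀ x : V.interval, f x.1 = (h x).1 := by
  have ex : ∀ v, ∃ z, Rel h v z := by
    intro v
    obtain ⟨N, hN⟩ := exists_shift v
    obtain ⟨a, rfl⟩ := hN (N + 1) (by omega) (by omega)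
    exact ⟨_, rel_shift hh _ (by omega) a⟩
  choose f hf using ex
  have f_eq : ∀ {v z}, Rel h v z → f v = z := fun hr => rel_unique hh (hf _) hr
  have f_add : ∀ x y, f (x + y) = f x + f y := fun x y => f_eq (rel_add hh (hf x) (hf y))
  have f_int : ∀ x : V.interval, f x.1 = (h x).1 := by
    intro x
    apply f_eq
    refine ⟨1, one_pos, x, ⟨0, le_rfl, V.unit_nonneg⟩, ?_, ?_⟩
    · simp
    · rw [hh.2.2.1 ⟨0, le_rfl, V.unit_nonneg⟩ rfl]; simp
  have f_inf : ∀ x y, f (x ⊓ y) = f x ⊓ f y := by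
    intro x y
    obtain ⟨N, hN⟩ := exists_shift x
    obtain ⟨M, hM⟩ := exists_shift y
    obtain ⟨n, hn1, hn2, hn⟩ : ∃ n : ℕ, N ≤ n ∧ M ≤ n ∧ 0 < n :=
      ⟨N + M + 1, by omega, by omega, by omega⟩
    obtain ⟨a, rfl⟩ := hN n hn1 hn
    obtain ⟨b, rfl⟩ := hM n hn2 hn
    have hi : 0 ≤ a.1 ⊓ b.1 ∧ a.1 ⊓ b.1 ≤ V.unit :=
      ⟨le_inf a.2.1 b.2.1, inf_le_left.trans a.2.2⟩
    rw [f_eq (rel_shift hh n hn a), f_eq (rel_shift hh n hn b), ← inf_sub, ← inf_sub,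
      ← smul_inf'' _ (by positivity), ← smul_inf'' _ (by positivity),
      ← hinf hh a b ⟨_, hi⟩ rfl, ← f_eq (rel_shift hh n hn ⟨_, hi⟩)]
  let F : V.carrier →+ W.carrier := AddMonoidHom.mk' f f_add
  refine ⟨f, ⟨⟨f_add, fun q x => map_rat_smul F q x, f_inf, ?_, ?_⟩, f_int⟩, ?_⟩
  · intro x y
    have h1 : f (x ⊓ y) + f (x ⊔ y) = f x + f y := by
      rw [← f_add, inf_add_sup, f_add]
    rw [f_inf, ← inf_add_sup (f x)] at h1
    exact add_left_cancel h1
  · have := f_int ⟨V.unit, V.unit_nonneg, le_rfl⟩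
    rw [hunit hh ⟨V.unit, V.unit_nonneg, le_rfl⟩ rfl] at this
    exact this
  · rintro g ⟨⟨g1, g2, -⟩, g3⟩
    funext v
    obtain ⟨n, hn, a, b, hv, hz⟩ := hf v
    have gs : ∀ x y, g (x - y) = g x - g y := fun x y =>
      map_sub (AddMonoidHom.mk' g g1) x y
    rw [hz, ← g3, ← g3, ← gs, ← g2, ← hv]

end Ext
end GammaQ

namespace GammaQ

local notation:65 x:65 "⊹" y:66 => MVAlgebra.oplus x y
local notation:max "∼" x:max => MVAlgebra.star x
local notation "𝟘" => MVAlgebra.zero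
local notation "𝟙" => MVAlgebra.star MVAlgebra.zero

section MV

variable {A : Type} [MVAlgebra A]

theorem oa (x y z : A) : x ⊹ y ⊹ z = x ⊹ (y ⊹ z) := MVAlgebra.oplus_assoc x y z
theorem oc (x y : A) : x ⊹ y = y ⊹ x := MVAlgebra.oplus_comm x y
theorem ss (x : A) : ∼(∼x) = x := MVAlgebra.star_star x
theorem oz (x : A) : x ⊹ 𝟘 = x := MVAlgebra.oplus_zero x
theorem zo (x : A) : 𝟘 ⊹ x = x := by rw [oc, oz]
theorem io (x : A) : 𝟙 ⊹ x = 𝟙 := MVAlgebra.oplus_star_zero x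
theorem oi (x : A) : x ⊹ 𝟙 = 𝟙 := by rw [oc, io]
theorem luk (x y : A) : ∼(∼x ⊹ y) ⊹ y = ∼(∼y ⊹ x) ⊹ x := MVAlgebra.lukasiewicz x y

theorem so (x : A) : ∼x ⊹ x = 𝟙 := by
  have := luk x 𝟙
  rw [oi, ss, zo] at this
  exact this.symm

theorem os (x : A) : x ⊹ ∼x = 𝟙 := by rw [oc, so]

theorem ex_of_le {x y : A} (h : ∼x ⊹ y = 𝟙) : x ⊹ ∼(∼y ⊹ x) = y := by
  have := luk x y
  rw [h, ss, zo, oc] at this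
  exact this.symm

theorem le_of_ex {x y z : A} (h : x ⊹ z = y) : ∼x ⊹ y = 𝟙 := by
  rw [← h, ← oa, so, io]

instance mvPO : PartialOrder A where
  le x y := ∼x ⊹ y = 𝟙
  le_refl x := so x
  le_trans x y z h1 h2 := by
    have e1 := ex_of_le h1
    have e2 := ex_of_le h2
    refine le_of_ex (z := ∼(∼y ⊹ x) ⊹ ∼(∼z ⊹ y)) ?_
    rw [← oa, e1, e2]
  le_antisymm x y h1 h2 := by
    have := ex_of_le h1
    rw [h2, ss, oz] at this
    exact this

theorem le_def (x y : A) : x ≤ y ↔ ∼x ⊹ y = 𝟙 := Iff.rfl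

theorem le_add (x y : A) : x ≤ x ⊹ y := le_of_ex rfl
theorem le_add' (x y : A) : x ≤ y ⊹ x := by rw [oc]; exact le_add x y
theorem zero_le' (x : A) : 𝟘 ≤ x := io x
theorem le_one' (x : A) : x ≤ 𝟙 := oi _

theorem add_mono_left {x y : A} (h : x ≤ y) (c : A) : x ⊹ c ≤ y ⊹ c := by
  have := ex_of_le h
  refine le_of_ex (z := ∼(∼y ⊹ x)) ?_
  rw [oa, oc c, ← oa, this]

theorem add_mono_right {x y : A} (h : x ≤ y) (c : A) : c ⊹ x ≤ c ⊹ y := by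
  rw [oc c, oc c]; exact add_mono_left h c

theorem add_mono {x y z w : A} (h : x ≤ y) (h' : z ≤ w) : x ⊹ z ≤ y ⊹ w :=
  (add_mono_left h z).trans (add_mono_right h' y)

theorem star_anti {x y : A} (h : x ≤ y) : ∼y ≤ ∼x := by
  rw [le_def, ss, oc]; exact h

theorem orth_symm {x y : A} (h : x ≤ ∼y) : y ≤ ∼x := by
  have := star_anti h
  rwa [ss] at this

theorem star_le {x y : A} (h : ∼x ≤ y) : ∼y ≤ x := by
  have := star_anti h
  rwa [ss] at this

theorem resid (x y z : A) : x ≤ y ⊹ z ↔ ∼(∼x ⊹ z) ≤ y := by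
  rw [le_def, le_def, ss, oc y, oa]

instance mvLattice : Lattice A :=
  { mvPO with
    sup := fun x y => ∼(∼x ⊹ y) ⊹ y
    inf := fun x y => ∼(∼(∼(∼x) ⊹ ∼y) ⊹ ∼y)
    le_sup_right := fun x y => le_add' _ _
    le_sup_left := fun x y => by
      show x ≤ ∼(∼x ⊹ y) ⊹ y
      rw [luk]; exact le_add' _ _
    sup_le := fun x y z h1 h2 => by
      have e := ex_of_le h2
      show ∼(∼x ⊹ y) ⊹ y ≤ z
      rw [← e, oc y]
      exact add_mono_left (star_anti (add_mono_left (star_anti h1) y)) y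
    inf_le_right := fun x y => star_le (le_add' _ _)
    inf_le_left := fun x y => by
      show ∼(∼(∼(∼x) ⊹ ∼y) ⊹ ∼y) ≤ x
      rw [luk]; exact star_le (le_add' _ _)
    le_inf := fun x y z h1 h2 => by
      have e := ex_of_le (star_anti h2)
      show x ≤ ∼(∼(∼(∼y) ⊹ ∼z) ⊹ ∼z)
      apply orth_symm
      rw [← e, oc (∼z)]
      exact add_mono_left (star_anti (add_mono_left (star_anti (star_anti h1)) _)) _ }

theorem sub_self' {a c : A} (h : a ≤ ∼c) : ∼(∼(a ⊹ c) ⊹ c) = a := by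
  have := luk (∼a) c
  rw [ss] at this
  rw [this, oc (∼c), (le_def _ _).1 h, ss, zo, ss]

theorem cancel_le {a b c : A} (ha : a ≤ ∼c) (h : a ⊹ c ≤ b ⊹ c) : a ≤ b := by
  have := (resid _ _ _).1 h
  rwa [sub_self' ha] at this

theorem ex_diff {c z : A} (h : c ≤ z) : ∃ w, w ≤ ∼c ∧ w ⊹ c = z := by
  refine ⟨∼(∼z ⊹ c), ?_, ?_⟩
  · rw [le_def, ss, oa, os, oi]
  · rw [oc]; exact ex_of_le h

theorem orth_assoc {a b c : A} (h1 : a ≤ ∼b) (h2 : a ⊹ b ≤ ∼c) : a ≤ ∼(b ⊹ c) := by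
  have h3 := add_mono_left (orth_symm h2) b
  have h4 := sub_self' h1
  apply orth_symm
  rw [oc, ← h4, ss]
  exact h3

theorem orth_assoc' {a b c : A} (h1 : b ≤ ∼c) (h2 : a ≤ ∼(b ⊹ c)) : a ⊹ b ≤ ∼c := by
  have := orth_assoc (orth_symm h1) (c := a) (by rw [oc c]; exact orth_symm h2)
  rw [oc]
  exact orth_symm this

theorem shuffle {p q r s : A} (h1 : p ≤ ∼q) (h2 : r ≤ ∼s) (h : p ⊹ q ≤ ∼(r ⊹ s)) :
    p ⊹ r ≤ ∼(q ⊹ s) := by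
  have hp := orth_assoc h1 h
  have hq : q ≤ ∼(r ⊹ s) := (le_add' q p).trans h
  have hqr : q ⊹ r ≤ ∼s := orth_assoc' h2 hq
  have hrq : r ≤ ∼q := orth_symm (hq.trans (star_anti (le_add r s)))
  have hr : r ≤ ∼(q ⊹ s) := orth_assoc hrq (by rw [oc]; exact hqr)
  apply orth_assoc' hr
  have e : r ⊹ (q ⊹ s) = q ⊹ (r ⊹ s) := by rw [← oa, oc r, oa]
  rw [e]; exact hp

theorem four (p q r s : A) : p ⊹ q ⊹ (r ⊹ s) = p ⊹ r ⊹ (q ⊹ s) := by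
  rw [oa, oa, ← oa q, oc q, oa r]

theorem half_cancel {a b : A} (ha : a ≤ ∼a) (_hb : b ≤ ∼b) (h : a ⊹ a ≤ b ⊹ b) : a ≤ b := by
  obtain ⟨a', ha', ea⟩ := ex_diff (inf_le_left : a ⊓ b ≤ a)
  obtain ⟨b', hb', eb⟩ := ex_diff (inf_le_right : a ⊓ b ≤ b)
  have hinf : a' ⊓ b' ≤ 𝟘 := by
    apply cancel_le (c := a ⊓ b) (inf_le_left.trans ha')
    rw [zo]
    apply le_inf
    · exact (add_mono_left inf_le_left _).trans ea.le
    · exact (add_mono_left inf_le_right _).trans eb.le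
  have h1 : a' ⊹ a' ≤ b' ⊹ b' := by
    apply cancel_le (c := (a ⊓ b) ⊹ (a ⊓ b))
    · exact shuffle ha' ha' (by rw [ea]; exact ha)
    · rw [four, ea, four, eb]; exact h
  have h2 : a' ≤ b' ⊹ b' := (le_add _ _).trans h1
  have h3 : ∼(∼a' ⊹ b') ≤ b' := (resid _ _ _).1 h2
  have h4 : ∼(∼a' ⊹ b') ≤ a' := (resid _ _ _).1 (le_add _ _)
  have h5 : a' ≤ 𝟘 ⊹ b' := (resid _ _ _).2 ((le_inf h4 h3).trans hinf)
  rw [zo] at h5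
  exact ea.ge.trans ((add_mono_left h5 _).trans eb.le)

theorem oplus_eq_inf (x y : A) : (y ⊓ ∼x) ⊹ x = y ⊹ x := by
  apply le_antisymm (add_mono_left inf_le_left _)
  obtain ⟨w, hw, e⟩ := ex_diff (le_add' x y)
  rw [← e]
  exact add_mono_left (le_inf (cancel_le hw e.le) hw) _

theorem odot_zero_iff (x y : A) : MVAlgebra.odot x y = 𝟘 ↔ x ≤ ∼y := by
  rw [le_def, MVAlgebra.odot]
  constructor
  · intro h; rw [← ss (∼x ⊹ ∼y), h]
  · intro h; rw [h, ss]

end MV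

section DMV

variable {A : Type} [DMVAlgebra A]

/-- Half of an element. -/
def half (x : A) : A := DMVAlgebra.delta 2 x

theorem half_add_half (x : A) : half x ⊹ half x = x := by
  have := DMVAlgebra.delta_nmul 2 (by norm_num) x
  simp only [MVAlgebra.nmul] at this
  rwa [zo] at this

theorem half_orth_self (x : A) : half x ≤ ∼(half x) := by
  have := DMVAlgebra.delta_odot 2 (by norm_num) x
  simp only [MVAlgebra.nmul] at this
  rwa [zo, odot_zero_iff] at this

theorem half_le_iff {x y : A} : half x ≤ half y ↔ x ≤ y := by
  constructor
  · intro h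
    rw [← half_add_half x, ← half_add_half y]
    exact add_mono h h
  · intro h
    apply half_cancel (half_orth_self x) (half_orth_self y)
    rwa [half_add_half, half_add_half]

theorem half_orth (x y : A) : half x ≤ ∼(half y) :=
  (half_le_iff.2 (le_one' x)).trans ((half_orth_self 𝟙).trans (star_anti (half_le_iff.2 (le_one' y))))

theorem half_unique {w x : A} (hw : w ≤ ∼w) (h : w ⊹ w = x) : half x = w := by
  apply le_antisymm
  · exact half_cancel (half_orth_self x) hw (by rw [half_add_half, h])
  · exact half_cancel hw (half_orth_self x) (by rw [half_add_half, h])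

theorem half_surj {w : A} (hw : w ≤ half 𝟙) : half (w ⊹ w) = w :=
  half_unique (hw.trans ((half_orth_self 𝟙).trans (star_anti hw))) rfl

theorem half_oplus {x y : A} (h : x ≤ ∼y) : half (x ⊹ y) = half x ⊹ half y := by
  apply half_unique
  · apply shuffle (half_orth_self x) (half_orth_self y)
    rwa [half_add_half, half_add_half]
  · rw [four, half_add_half, half_add_half]

/-- The midpoint. -/
def avg (x y : A) : A := half x ⊹ half y

theorem avg_comm (x y : A) : avg x y = avg y x := oc _ _

theorem avg_self (x : A) : avg x x = x := half_add_half x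

theorem avg_star (x : A) : avg x (∼x) = half 𝟙 := by
  rw [avg, ← half_oplus (by rw [ss]), os]

theorem avg_medial (a b c d : A) : avg (avg a b) (avg c d) = avg (avg a c) (avg b d) := by
  simp only [avg]
  rw [half_oplus (half_orth _ _), half_oplus (half_orth _ _), half_oplus (half_orth _ _),
    half_oplus (half_orth _ _), four]

theorem avg_le_iff {x y : A} (c : A) : avg x c ≤ avg y c ↔ x ≤ y := by
  constructor
  · intro h
    exact half_le_iff.1 (cancel_le (half_orth x c) h)
  · intro h
    exact add_mono_left (half_le_iff.2 h) _

theorem avg_inj {x y : A} (c : A) (h : avg x c = avg y c) : x = y :=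
  le_antisymm ((avg_le_iff c).1 h.le) ((avg_le_iff c).1 h.ge)

theorem avg_convex {z c : A} (h1 : avg 𝟘 c ≤ z) (h2 : z ≤ avg 𝟙 c) : ∃ x, avg x c = z := by
  obtain ⟨w, hw, e⟩ := ex_diff ((le_add' (half c) (half 𝟘)).trans h1)
  refine ⟨w ⊹ w, ?_⟩
  rw [avg, half_surj, e]
  apply cancel_le hw
  rw [e]; exact h2

theorem avg_inf (x y c : A) : avg (x ⊓ y) c = avg x c ⊓ avg y c := by
  apply le_antisymm
  · exact le_inf ((avg_le_iff c).2 inf_le_left) ((avg_le_iff c).2 inf_le_right)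
  · have h1 : avg 𝟘 c ≤ avg x c ⊓ avg y c :=
      le_inf ((avg_le_iff c).2 (zero_le' _)) ((avg_le_iff c).2 (zero_le' _))
    have h2 : avg x c ⊓ avg y c ≤ avg 𝟙 c := inf_le_left.trans ((avg_le_iff c).2 (le_one' _))
    obtain ⟨z, hz⟩ := avg_convex h1 h2
    rw [← hz, avg_le_iff]
    apply le_inf
    · rw [← avg_le_iff c, hz]; exact inf_le_left
    · rw [← avg_le_iff c, hz]; exact inf_le_right

theorem avg_sup (x y c : A) : avg (x ⊔ y) c = avg x c ⊔ avg y c := by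
  apply le_antisymm
  · have h1 : avg 𝟘 c ≤ avg x c ⊔ avg y c := le_sup_of_le_left ((avg_le_iff c).2 (zero_le' _))
    have h2 : avg x c ⊔ avg y c ≤ avg 𝟙 c :=
      sup_le ((avg_le_iff c).2 (le_one' _)) ((avg_le_iff c).2 (le_one' _))
    obtain ⟨z, hz⟩ := avg_convex h1 h2
    rw [← hz, avg_le_iff]
    apply sup_le
    · rw [← avg_le_iff c, hz]; exact le_sup_left
    · rw [← avg_le_iff c, hz]; exact le_sup_right
  · exact sup_le ((avg_le_iff c).2 le_sup_left) ((avg_le_iff c).2 le_sup_right)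

theorem star_avg (x y : A) : ∼(avg x y) = avg (∼x) (∼y) := by
  apply avg_inj (avg x y)
  rw [avg_comm, avg_star, avg_medial, avg_comm _ x, avg_comm _ y, avg_star, avg_star, avg_self]

/-- Scaling by one half in the symmetric picture. -/
def sc (x : A) : A := avg x (half 𝟙)

theorem sc_avg (x y : A) : sc (avg x y) = avg (sc x) (sc y) := by
  unfold sc
  rw [← avg_medial, avg_self]

theorem sc_inf (x y : A) : sc (x ⊓ y) = sc x ⊓ sc y := avg_inf _ _ _
theorem sc_sup (x y : A) : sc (x ⊔ y) = sc x ⊔ sc y := avg_sup _ _ _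

theorem star_half_one : ∼(half 𝟙 : A) = half 𝟙 := by
  have h1 : ∼(avg (𝟘 : A) (∼𝟘)) = avg (∼𝟘) (∼(∼𝟘)) := star_avg _ _
  rwa [ss, avg_comm _ 𝟘, avg_star] at h1

theorem sc_star (x : A) : sc (∼x) = ∼(sc x) := by
  unfold sc
  rw [star_avg, star_half_one]

theorem sc_half : sc (half 𝟙 : A) = half 𝟙 := avg_self _

theorem scn_le_iff (n : ℕ) (x y : A) : sc^[n] x ≤ sc^[n] y ↔ x ≤ y := by
  induction n generalizing x y with
  | zero => rfl
  | succ n ih =>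
    rw [Function.iterate_succ_apply, Function.iterate_succ_apply, ih]
    exact avg_le_iff _

theorem scn_inj (n : ℕ) {x y : A} (h : sc^[n] x = sc^[n] y) : x = y :=
  le_antisymm ((scn_le_iff n x y).1 h.le) ((scn_le_iff n y x).1 h.ge)

theorem scn_half (n : ℕ) : sc^[n] (half 𝟙 : A) = half 𝟙 :=
  Function.iterate_fixed sc_half n

theorem scn_op (op : A → A → A) (hop : ∀ x y, sc (op x y) = op (sc x) (sc y)) (n : ℕ) (x y : A) :
    sc^[n] (op x y) = op (sc^[n] x) (sc^[n] y) := by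
  induction n generalizing x y with
  | zero => rfl
  | succ n ih => simp only [Function.iterate_succ_apply, hop, ih]

theorem scn_star (n : ℕ) (x : A) : sc^[n] (∼x) = ∼(sc^[n] x) := by
  induction n generalizing x with
  | zero => rfl
  | succ n ih => simp only [Function.iterate_succ_apply, sc_star, ih]

theorem scn_comm (n m : ℕ) (x : A) : sc^[n] (sc^[m] x) = sc^[m] (sc^[n] x) := by
  rw [← Function.iterate_add_apply, ← Function.iterate_add_apply, add_comm]

theorem scn_convex (n : ℕ) (z : A) (h1 : sc^[n] 𝟘 ≤ z) (h2 : z ≤ sc^[n] 𝟙) :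
    ∃ x, sc^[n] x = z := by
  induction n generalizing z with
  | zero => exact ⟨z, rfl⟩
  | succ n ih =>
    rw [Function.iterate_succ_apply'] at h1 h2
    obtain ⟨w, hw⟩ := avg_convex (z := z) (c := half 𝟙)
      (((avg_le_iff _).2 (zero_le' _)).trans h1) (h2.trans ((avg_le_iff _).2 (le_one' _)))
    subst hw
    obtain ⟨x, hx⟩ := ih w ((avg_le_iff _).1 h1) ((avg_le_iff _).1 h2)
    exact ⟨x, by rw [Function.iterate_succ_apply', hx]; rfl⟩

variable (A) in
/-- The defining equivalence relation: a pair `(k, x)` stands for `x` scaled by a power of two. -/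
def vSetoid : Setoid (ℕ × A) where
  r p q := sc^[q.1] p.2 = sc^[p.1] q.2
  iseqv := by
    refine ⟨fun _ => rfl, fun h => h.symm, ?_⟩
    rintro ⟨k, x⟩ ⟨l, y⟩ ⟨m, z⟩ h1 h2
    simp only at h1 h2 ⊢
    apply scn_inj l
    rw [scn_comm, h1, scn_comm, h2, scn_comm]

variable (A) in
/-- The vector lattice of a DMV-algebra. -/
def VV : Type := Quotient (vSetoid A)

/-- The class of `(k, x)`. -/
def mk (k : ℕ) (x : A) : VV A := Quotient.mk (vSetoid A) (k, x)

theorem mk_eq_iff (k l : ℕ) (x y : A) : mk k x = mk l y ↔ sc^[l] x = sc^[k] y :=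
  ⟨fun h => Quotient.exact (s := vSetoid A) h, fun h => Quotient.sound (s := vSetoid A) h⟩

theorem mk_inj (k : ℕ) {x y : A} (h : mk k x = mk k y) : x = y :=
  scn_inj k ((mk_eq_iff _ _ _ _).1 h)

theorem mk_scn (k n : ℕ) (x : A) : mk (k + n) (sc^[n] x) = mk k x := by
  rw [mk_eq_iff, ← Function.iterate_add_apply]

theorem mk_sc (k : ℕ) (x : A) : mk (k + 1) (sc x) = mk k x := mk_scn k 1 x

theorem rep (a : VV A) : ∃ k x, a = mk k x := by
  obtain ⟨⟨k, x⟩, rfl⟩ := Quotient.exists_rep a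
  exact ⟨k, x, rfl⟩

theorem rep2 (a b : VV A) : ∃ (k : ℕ) (p : A × A), a = mk k p.1 ∧ b = mk k p.2 := by
  obtain ⟨k, x, rfl⟩ := rep a
  obtain ⟨l, y, rfl⟩ := rep b
  exact ⟨k + l, (sc^[l] x, sc^[k] y), (mk_scn _ _ _).symm, by rw [add_comm, mk_scn]⟩

theorem rep3 (a b c : VV A) : ∃ (k : ℕ) (x y z : A), a = mk k x ∧ b = mk k y ∧ c = mk k z := by
  obtain ⟨k, p, rfl, rfl⟩ := rep2 a b
  obtain ⟨l, z, rfl⟩ := rep c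
  exact ⟨k + l, sc^[l] p.1, sc^[l] p.2, sc^[k] z, (mk_scn _ _ _).symm, (mk_scn _ _ _).symm,
    by rw [add_comm, mk_scn]⟩

/-- Lift a binary operation commuting with `sc`, with a level shift. -/
noncomputable def lift2 (d : ℕ) (op : A → A → A) (a b : VV A) : VV A :=
  mk ((rep2 a b).choose + d) (op (rep2 a b).choose_spec.choose.1 (rep2 a b).choose_spec.choose.2)

theorem lift2_mk (d : ℕ) (op : A → A → A) (hop : ∀ x y, sc (op x y) = op (sc x) (sc y))
    (k : ℕ) (x y : A) : lift2 d op (mk k x) (mk k y) = mk (k + d) (op x y) := by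
  obtain ⟨h1, h2⟩ := (rep2 (mk k x) (mk k y)).choose_spec.choose_spec
  unfold lift2
  generalize (rep2 (mk k x) (mk k y)).choose_spec.choose = p at *
  generalize (rep2 (mk k x) (mk k y)).choose = l at *
  rw [mk_eq_iff] at h1 h2 ⊢
  rw [scn_op op hop, scn_op op hop, add_comm k, add_comm l]
  simp only [Function.iterate_add_apply]
  rw [h1, h2]

noncomputable instance : Add (VV A) := ⟨lift2 1 avg⟩
instance : Zero (VV A) := ⟨mk 0 (half 𝟙)⟩
instance : Neg (VV A) := ⟨Quotient.map' (s₁ := vSetoid A) (s₂ := vSetoid A)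
  (fun p => (p.1, ∼p.2)) (by
    rintro ⟨k, x⟩ ⟨l, y⟩ h
    change sc^[l] x = sc^[k] y at h
    show sc^[l] (∼x) = sc^[k] (∼y)
    rw [scn_star, scn_star, h])⟩

theorem add_mk (k : ℕ) (x y : A) : mk k x + mk k y = mk (k + 1) (avg x y) :=
  lift2_mk 1 avg sc_avg k x y

theorem neg_mk (k : ℕ) (x : A) : - mk k x = mk k (∼x) := rfl

theorem zero_mk (k : ℕ) : (0 : VV A) = mk k (half 𝟙) := by
  show mk 0 (half 𝟙) = _
  rw [mk_eq_iff, scn_half]; rfl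

noncomputable instance : AddCommGroup (VV A) where
  add_assoc a b c := by
    obtain ⟨k, x, y, z, rfl, rfl, rfl⟩ := rep3 a b c
    rw [add_mk, add_mk, ← mk_sc k z, ← mk_sc k x, add_mk, add_mk]
    congr 1
    unfold sc
    rw [avg_comm z, avg_medial x y]
  zero_add a := by
    obtain ⟨k, x, rfl⟩ := rep a
    rw [zero_mk k, add_mk, avg_comm]
    exact mk_sc k x
  add_zero a := by
    obtain ⟨k, x, rfl⟩ := rep a
    rw [zero_mk k, add_mk]
    exact mk_sc k x
  add_comm a b := by
    obtain ⟨k, p, rfl, rfl⟩ := rep2 a b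
    rw [add_mk, add_mk, avg_comm]
  neg_add_cancel a := by
    obtain ⟨k, x, rfl⟩ := rep a
    rw [neg_mk, add_mk, avg_comm, avg_star, ← zero_mk]
  nsmul := nsmulRec
  zsmul := zsmulRec

instance : LE (VV A) := ⟨fun a b => ∃ k x y, a = mk k x ∧ b = mk k y ∧ x ≤ y⟩

theorem mk_le_iff (k : ℕ) (x y : A) : mk k x ≤ mk k y ↔ x ≤ y := by
  constructor
  · rintro ⟨l, x', y', h1, h2, h⟩
    rw [mk_eq_iff] at h1 h2
    rw [← scn_le_iff l, h1, h2, scn_le_iff]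
    exact h
  · exact fun h => ⟨k, x, y, rfl, rfl, h⟩

noncomputable instance : Lattice (VV A) where
  le_refl a := by
    obtain ⟨k, x, rfl⟩ := rep a
    rw [mk_le_iff]
  le_trans a b c := by
    obtain ⟨k, x, y, z, rfl, rfl, rfl⟩ := rep3 a b c
    simp only [mk_le_iff]
    exact le_trans
  le_antisymm a b := by
    obtain ⟨k, p, rfl, rfl⟩ := rep2 a b
    simp only [mk_le_iff]
    exact fun h1 h2 => by rw [le_antisymm h1 h2]
  sup := lift2 0 (· ⊔ ·)
  inf := lift2 0 (· ⊓ ·)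
  le_sup_left a b := by
    obtain ⟨k, p, rfl, rfl⟩ := rep2 a b
    rw [lift2_mk 0 _ sc_sup, add_zero, mk_le_iff]
    exact le_sup_left
  le_sup_right a b := by
    obtain ⟨k, p, rfl, rfl⟩ := rep2 a b
    rw [lift2_mk 0 _ sc_sup, add_zero, mk_le_iff]
    exact le_sup_right
  sup_le a b c := by
    obtain ⟨k, x, y, z, rfl, rfl, rfl⟩ := rep3 a b c
    rw [lift2_mk 0 _ sc_sup, add_zero, mk_le_iff, mk_le_iff, mk_le_iff]
    exact sup_le
  inf_le_left a b := by
    obtain ⟨k, p, rfl, rfl⟩ := rep2 a b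
    rw [lift2_mk 0 _ sc_inf, add_zero, mk_le_iff]
    exact inf_le_left
  inf_le_right a b := by
    obtain ⟨k, p, rfl, rfl⟩ := rep2 a b
    rw [lift2_mk 0 _ sc_inf, add_zero, mk_le_iff]
    exact inf_le_right
  le_inf a b c := by
    obtain ⟨k, x, y, z, rfl, rfl, rfl⟩ := rep3 a b c
    rw [lift2_mk 0 _ sc_inf, add_zero, mk_le_iff, mk_le_iff, mk_le_iff]
    exact le_inf

theorem inf_mk (k : ℕ) (x y : A) : mk k x ⊓ mk k y = mk k (x ⊓ y) :=
  lift2_mk 0 _ sc_inf k x y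

instance : CovariantClass (VV A) (VV A) (· + ·) (· ≤ ·) := ⟨by
  intro a b c
  obtain ⟨k, x, y, z, rfl, rfl, rfl⟩ := rep3 a b c
  simp only [add_mk]
  rw [mk_le_iff, mk_le_iff, avg_comm x, avg_comm x, avg_le_iff]
  exact id⟩

/-- The unit. -/
def uu : VV A := mk 0 𝟙

/-- The embedding. -/
def gg (x : A) : VV A := mk 0 (avg x 𝟙)

theorem gg_zero : gg (𝟘 : A) = 0 := by
  rw [gg, avg_star]; rfl

theorem gg_one : gg (𝟙 : A) = uu := by
  rw [gg, avg_self]; rfl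

theorem gg_star (x : A) : gg x + gg (∼x) = uu := by
  rw [gg, gg, add_mk, avg_medial, avg_star, avg_self, avg_comm]
  exact mk_sc 0 _

theorem gg_le (x y : A) : gg x ≤ gg y ↔ x ≤ y := by
  rw [gg, gg, mk_le_iff, avg_le_iff]

theorem gg_inf (x y : A) : gg (x ⊓ y) = gg x ⊓ gg y := by
  rw [gg, gg, gg, inf_mk, avg_inf]

theorem half_zero : half (𝟘 : A) = 𝟘 := half_unique (zero_le' _) (zo _)

theorem gg_add {x y : A} (h : x ≤ ∼y) : gg (x ⊹ y) = gg x + gg y := by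
  rw [gg, gg, gg, add_mk, avg_medial, avg_self, ← mk_sc]
  congr 1
  rw [sc, ← avg_star 𝟘, avg_medial, avg_self]
  congr 1
  rw [avg, half_zero, oz, half_oplus h]; rfl

theorem gg_oplus (x y : A) : gg (x ⊹ y) = uu ⊓ (gg x + gg y) := by
  rw [← oplus_eq_inf, gg_add inf_le_right, gg_inf, inf_add, add_comm (gg (∼y)), gg_star,
    inf_comm]

theorem gg_delta (n : ℕ) (hn : 0 < n) (x : A) : n • gg (DMVAlgebra.delta n x) = gg x := by
  have key : ∀ k, k ≤ n → gg (MVAlgebra.nmul k (DMVAlgebra.delta n x))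
      = k • gg (DMVAlgebra.delta n x) := by
    intro k
    induction k with
    | zero => intro _; rw [zero_smul]; exact gg_zero
    | succ k ih =>
      intro hk
      have h1 := (odot_zero_iff _ _).1 (DMVAlgebra.delta_odot n hn x)
      have mono : ∀ d, MVAlgebra.nmul k (DMVAlgebra.delta n x)
          ≤ MVAlgebra.nmul (k + d) (DMVAlgebra.delta n x) := by
        intro d
        induction d with
        | zero => exact le_rfl
        | succ d ih => exact ih.trans (le_add _ _)
      have h2 := mono (n - 1 - k)
      rw [show k + (n - 1 - k) = n - 1 by omega] at h2
      rw [MVAlgebra.nmul, gg_add (h2.trans (orth_symm h1)), ih (by omega), succ_nsmul]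
  rw [← key n le_rfl, DMVAlgebra.delta_nmul n hn]

theorem gg_surj (a : VV A) (h0 : 0 ≤ a) (h1 : a ≤ uu) : ∃ x, gg x = a := by
  obtain ⟨k, y, rfl⟩ := rep a
  rw [zero_mk k, mk_le_iff] at h0
  rw [uu, ← mk_scn 0 k, zero_add, mk_le_iff] at h1
  have h2 : sc^[k] 𝟘 ≤ y := by
    refine le_trans ?_ h0
    rw [← scn_half k, scn_le_iff]
    exact zero_le' _
  obtain ⟨z, rfl⟩ := scn_convex k y h2 h1
  rw [← scn_half k, scn_le_iff, ← avg_star 𝟘] at h0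
  obtain ⟨x, rfl⟩ := avg_convex h0 (by rw [avg_self]; exact le_one' z)
  refine ⟨x, ?_⟩
  have := mk_scn 0 k (avg x 𝟙)
  rw [zero_add] at this
  exact this.symm

theorem mk_succ (k : ℕ) (x : A) : mk (k + 1) x = mk k x + mk k x := by
  rw [add_mk, avg_self]

theorem mk_one (k : ℕ) : mk k (𝟙 : A) = (2 ^ k) • uu := by
  induction k with
  | zero => rw [pow_zero, one_smul]; rfl
  | succ k ih => rw [mk_succ, ih, ← add_nsmul]; congr 1; ring

theorem vv_strong (v : VV A) : ∃ m : ℕ, v ≤ m • uu := by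
  obtain ⟨k, y, rfl⟩ := rep v
  refine ⟨2 ^ k, ?_⟩
  rw [← mk_one, mk_le_iff]
  exact le_one' _

theorem mk_zero_eq (y : A) : mk 0 y = gg y + gg y - uu := by
  rw [eq_sub_iff_add_eq, gg, ← mk_succ, uu, add_mk]

theorem vv_div (n : ℕ) (hn : 0 < n) (v : VV A) : ∃ z, n • z = v := by
  obtain ⟨k, y, rfl⟩ := rep v
  induction k with
  | zero =>
    rw [mk_zero_eq]
    refine ⟨gg (DMVAlgebra.delta n y) + gg (DMVAlgebra.delta n y) - gg (DMVAlgebra.delta n 𝟙), ?_⟩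
    rw [smul_sub, smul_add, gg_delta n hn, gg_delta n hn, gg_one]
  | succ k ih =>
    obtain ⟨z, hz⟩ := ih
    exact ⟨z + z, by rw [mk_succ, smul_add, hz]⟩

end DMV

section RatModule

variable {G : Type} [AddCommGroup G]
  (dv : ∀ n : ℕ, 0 < n → ∀ y : G, ∃ z, n • z = y)

/-- Rational scalar multiplication on a divisible group. -/
noncomputable def qs (q : ℚ) (v : G) : G := (dv q.den q.den_pos (q.num • v)).choose

theorem qs_spec (q : ℚ) (v : G) : q.den • qs dv q v = q.num • v :=
  (dv q.den q.den_pos (q.num • v)).choose_spec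

theorem tf_cancel (tf : ∀ n : ℕ, 0 < n → ∀ y : G, n • y = 0 → y = 0)
    (n : ℕ) (hn : 0 < n) {a b : G} (h : n • a = n • b) : a = b :=
  sub_eq_zero.1 (tf n hn _ (by rw [smul_sub, h, sub_self]))

theorem qs_eq (tf : ∀ n : ℕ, 0 < n → ∀ y : G, n • y = 0 → y = 0)
    (q : ℚ) (v w : G) (m : ℕ) (hm : 0 < m) (k : ℤ) (hq : q * m = k)
    (h : m • w = k • v) : qs dv q v = w := by
  apply tf_cancel tf (q.den * m) (Nat.mul_pos q.den_pos hm)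
  rw [mul_comm, mul_smul, qs_spec, mul_comm, mul_smul, h]
  rw [← natCast_zsmul, ← natCast_zsmul, ← mul_smul, ← mul_smul]
  congr 1
  have h1 := Rat.den_mul_eq_num q
  have : ((m * q.num : ℤ) : ℚ) = ((q.den * k : ℤ) : ℚ) := by
    push_cast
    rw [← h1, ← hq]; ring
  exact_mod_cast this

/-- The rational vector space structure on a divisible torsion-free group. -/
@[reducible]
noncomputable def qModule (tf : ∀ n : ℕ, 0 < n → ∀ y : G, n • y = 0 → y = 0) : Module ℚ G where
  smul := qs dv
  one_smul v := qs_eq dv tf 1 v v 1 one_pos 1 (by simp) (by simp)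
  zero_smul v := qs_eq dv tf 0 v 0 1 one_pos 0 (by simp) (by simp)
  smul_zero q := qs_eq dv tf q 0 0 q.den q.den_pos q.num (Rat.mul_den_eq_num q) (by simp)
  smul_add q x y := qs_eq dv tf q _ _ q.den q.den_pos q.num (Rat.mul_den_eq_num q) (by
    show q.den • (qs dv q x + qs dv q y) = _
    rw [smul_add, qs_spec, qs_spec, smul_add])
  add_smul p q x := qs_eq dv tf (p + q) _ _ (p.den * q.den) (Nat.mul_pos p.den_pos q.den_pos)
    (p.num * q.den + q.num * p.den) (by
      push_cast
      rw [← Rat.mul_den_eq_num p, ← Rat.mul_den_eq_num q]; ring) (by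
      show (p.den * q.den) • (qs dv p x + qs dv q x) = _
      have e : (p.den * q.den) • qs dv p x = q.den • p.den • qs dv p x := by
        rw [mul_comm, mul_smul]
      rw [smul_add, e, mul_smul p.den q.den, qs_spec, qs_spec, add_smul, mul_comm p.num, mul_comm q.num,
        mul_smul, mul_smul, natCast_zsmul, natCast_zsmul])
  mul_smul p q x := qs_eq dv tf (p * q) _ _ (p.den * q.den) (Nat.mul_pos p.den_pos q.den_pos)
    (p.num * q.num) (by
      push_cast
      rw [← Rat.mul_den_eq_num p, ← Rat.mul_den_eq_num q]; ring) (by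
      show (p.den * q.den) • (qs dv p (qs dv q x)) = _
      rw [mul_comm p.den, mul_smul, qs_spec, smul_comm, qs_spec, mul_smul])

end RatModule

theorem part3 (D : Type) [DMVAlgebra D] : ∃ (V : UQVL) (g : D → V.interval),
      Function.Bijective g ∧
      (∀ x y : D, (g (MVAlgebra.oplus x y)).1 = V.unit ⊓ ((g x).1 + (g y).1)) ∧
      (∀ x : D, (g (MVAlgebra.star x)).1 = V.unit - (g x).1) ∧
      (g MVAlgebra.zero).1 = 0 ∧
      (∀ n : ℕ, 1 ≤ n → ∀ x : D,
        (g (DMVAlgebra.delta n x)).1 = ((n : ℚ)⁻¹) • (g x).1) := by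
  let M : Module ℚ (VV D) := qModule vv_div (fun n hn y h => eq_zero_of_nsmul n hn y h)
  have u0 : (0 : VV D) ≤ uu := by
    rw [← gg_zero, ← gg_one, gg_le]; exact zero_le' _
  let V : UQVL := { carrier := VV D, unit := uu, unit_nonneg := u0, unit_strong := vv_strong }
  have gi : ∀ x : D, 0 ≤ gg x ∧ gg x ≤ uu := by
    intro x
    rw [← gg_zero, ← gg_one, gg_le, gg_le]
    exact ⟨zero_le' _, le_one' _⟩
  refine ⟨V, fun x => ⟨gg x, gi x⟩, ⟨?_, ?_⟩, gg_oplus, ?_, gg_zero, ?_⟩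
  · intro x y h
    have h' : gg x = gg y := congrArg Subtype.val h
    exact le_antisymm ((gg_le _ _).1 h'.le) ((gg_le _ _).1 h'.ge)
  · rintro ⟨a, h0, h1⟩
    obtain ⟨x, hx⟩ := gg_surj a h0 h1
    exact ⟨x, Subtype.ext hx⟩
  · intro x
    exact eq_sub_of_add_eq' (gg_star x)
  · intro n hn x
    show gg (DMVAlgebra.delta n x) = (n : ℚ)⁻¹ • gg x
    have hn' : (n : ℚ) ≠ 0 := by positivity
    rw [← gg_delta n hn x, ← Nat.cast_smul_eq_nsmul ℚ, inv_smul_smul₀ hn']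

end GammaQ

/-- The functor `Γ_ℚ`, sending a ℚ-vector lattice with strong unit
`(V, u)` to its unit interval `[0, u]_V` (a DMV-algebra) and a unital lattice-linear
map to its restriction, establishes a categorical equivalence between `uQVL` and
`DMV`: restriction maps intervals to intervals, it induces a bijection on hom-sets
(full faithfulness, phrased as unique extension of interval homomorphisms), and every
DMV-algebra is isomorphic to some `[0, u]_V` (essential surjectivity). -/
theorem gammaQ_equivalence :
    -- restriction of a unital ℚ-linear lattice homomorphism stays in the interval
    (∀ (V W : UQVL) (f : V.carrier → W.carrier), IsUQVLHom V W f →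
      ∀ x : V.interval, 0 ≤ f x.1 ∧ f x.1 ≤ W.unit) ∧
    -- full and faithful: every DMV-homomorphism of intervals is the restriction of a
    -- unique arrow of uQVL
    (∀ (V W : UQVL) (h : V.interval → W.interval), IsIntervalDMVHom V W h →
      ∃! f : V.carrier → W.carrier,
        IsUQVLHom V W f ∧ ∀ x : V.interval, f x.1 = (h x).1) ∧
    -- essential surjectivity: every DMV-algebra is isomorphic to a unit interval
    (∀ (D : Type) [DMVAlgebra D], ∃ (V : UQVL) (g : D → V.interval),
      Function.Bijective g ∧
      (∀ x y : D, (g (MVAlgebra.oplus x y)).1 = V.unit ⊓ ((g x).1 + (g y).1)) ∧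
      (∀ x : D, (g (MVAlgebra.star x)).1 = V.unit - (g x).1) ∧
      (g MVAlgebra.zero).1 = 0 ∧
      (∀ n : ℕ, 1 ≤ n → ∀ x : D,
        (g (DMVAlgebra.delta n x)).1 = ((n : ℚ)⁻¹) • (g x).1)) := by
  exact ⟨GammaQ.part1, GammaQ.part2, fun D _ => GammaQ.part3 D⟩
end

section
/- The zerosets of elements of DMV_n are exactly the rational polyhedra in [0,1]^n: (i) for every rational polyhedron P ⊆ [0,1]^n there exists a continuous piecewise linear f : [0,1]^n → [0,1] with rational (indeed integer) coefficients such that P = f⁻¹(0); (ii) conversely, for every f ∈ DMV_n, the set f⁻¹(0) is a rational polyhedron. -/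
open scoped BigOperators

/-- The unit cube `[0,1]^n` in `ℝ^n`. -/
def Cube (n : ℕ) : Set (Fin n → ℝ) := {x | ∀ i, 0 ≤ x i ∧ x i ≤ 1}

/-- Elements of the free `n`-generated DMV-algebra `DMV_n`: continuous
`[0,1]`-valued functions on the cube that are piecewise linear with rational
coefficients, i.e. there are finitely many affine functions with rational
coefficients such that at every point `f` agrees with one of them. -/
def IsPWLQ {n : ℕ} (f : Cube n → ℝ) : Prop :=
  Continuous f ∧ (∀ x, 0 ≤ f x ∧ f x ≤ 1) ∧
  ∃ (k : ℕ) (c : Fin k → ℚ) (a : Fin k → Fin n → ℚ),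
    ∀ x : Cube n, ∃ j, f x = (c j : ℝ) + ∑ i, (a j i : ℝ) * (x : Fin n → ℝ) i

/-- Elements of the free `n`-generated MV-algebra `MV_n`: continuous
`[0,1]`-valued functions on the cube that are piecewise linear with integer
coefficients. -/
def IsPWLZ {n : ℕ} (f : Cube n → ℝ) : Prop :=
  Continuous f ∧ (∀ x, 0 ≤ f x ∧ f x ≤ 1) ∧
  ∃ (k : ℕ) (c : Fin k → ℤ) (a : Fin k → Fin n → ℤ),
    ∀ x : Cube n, ∃ j, f x = (c j : ℝ) + ∑ i, (a j i : ℝ) * (x : Fin n → ℝ) i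

/-- Ideal of `DMV_n`: a set of elements of `DMV_n` containing `0`, downward closed,
and closed under the pointwise truncated sum `f ⊕ g = min (f + g) 1`. -/
def IsIdealQ {n : ℕ} (J : Set (Cube n → ℝ)) : Prop :=
  (∀ f ∈ J, IsPWLQ f) ∧ ((fun _ => (0 : ℝ)) ∈ J) ∧
  (∀ f ∈ J, ∀ g : Cube n → ℝ, IsPWLQ g → (∀ x, g x ≤ f x) → g ∈ J) ∧
  (∀ f ∈ J, ∀ g ∈ J, (fun x => min (f x + g x) 1) ∈ J)

/-- `g` belongs to the ideal `(f]` of `DMV_n` generated by `f`. -/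
def memGen {n : ℕ} (f g : Cube n → ℝ) : Prop :=
  ∀ J : Set (Cube n → ℝ), IsIdealQ J → f ∈ J → g ∈ J

/-- Maximal ideal of `DMV_n`: a proper ideal maximal under inclusion. -/
def IsMaxIdealQ {n : ℕ} (M : Set (Cube n → ℝ)) : Prop :=
  IsIdealQ M ∧ (∃ g : Cube n → ℝ, IsPWLQ g ∧ g ∉ M) ∧
  ∀ J : Set (Cube n → ℝ), IsIdealQ J → (∃ g : Cube n → ℝ, IsPWLQ g ∧ g ∉ J) →
    M ⊆ J → J = M

/-- A point of `ℝ^n` with rational coordinates. -/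
def HasRatCoords {n : ℕ} (v : Fin n → ℝ) : Prop := ∀ i, ∃ q : ℚ, v i = (q : ℝ)

/-- A rational polyhedron in `ℝ^n`: a finite union of simplexes (convex hulls of
affinely independent finite sets) all of whose vertices have rational coordinates. -/
def IsRatPoly {n : ℕ} (P : Set (Fin n → ℝ)) : Prop :=
  ∃ (k : ℕ) (V : Fin k → Finset (Fin n → ℝ)),
    (∀ j, (∀ v ∈ V j, HasRatCoords v) ∧
      AffineIndependent ℝ ((↑) : ((V j : Set (Fin n → ℝ))) → (Fin n → ℝ))) ∧
    P = ⋃ j, convexHull ℝ (V j : Set (Fin n → ℝ))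

/-- The real affine function with rational coefficients `p`. -/
def ratAff {n : ℕ} (p : ℚ × (Fin n → ℚ)) (x : Fin n → ℝ) : ℝ :=
  (p.1 : ℝ) + ∑ i, (p.2 i : ℝ) * x i

lemma ratAff_continuous {n : ℕ} (p : ℚ × (Fin n → ℚ)) : Continuous (ratAff p) := by
  unfold ratAff; fun_prop

lemma ratAff_comb {n : ℕ} (p : ℚ × (Fin n → ℚ)) (x y : Fin n → ℝ) (a b : ℝ) (h : a + b = 1) :
    ratAff p (a • x + b • y) = a * ratAff p x + b * ratAff p y := by
  have : b = 1 - a := by linarith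
  subst this
  simp only [ratAff, Pi.add_apply, Pi.smul_apply, smul_eq_mul, mul_add, Finset.sum_add_distrib,
    Finset.mul_sum]
  have h1 : ∀ c : ℝ, ∀ z : Fin n → ℝ, ∑ i, (p.2 i : ℝ) * (c * z i) = ∑ i, c * ((p.2 i : ℝ) * z i) :=
    fun c z => Finset.sum_congr rfl fun i _ => by ring
  rw [h1, h1]; ring

lemma ratAff_neg {n : ℕ} (p : ℚ × (Fin n → ℚ)) (x : Fin n → ℝ) :
    ratAff (-p) x = - ratAff p x := by
  simp [ratAff, Finset.sum_neg_distrib]; ring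

lemma ratAff_ratCast {n : ℕ} (p : ℚ × (Fin n → ℚ)) (q : Fin n → ℚ) :
    ratAff p (fun i => (q i : ℝ)) = ((p.1 + ∑ i, p.2 i * q i : ℚ) : ℝ) := by
  simp [ratAff]

/-- The closed convex set cut out by finitely many rational affine inequalities. -/
def ratCell {n : ℕ} (T : Finset (ℚ × (Fin n → ℚ))) : Set (Fin n → ℝ) :=
  {x | ∀ p ∈ T, 0 ≤ ratAff p x}

lemma ratCell_convex {n : ℕ} (T : Finset (ℚ × (Fin n → ℚ))) : Convex ℝ (ratCell T) := by
  intro x hx y hy a b ha hb hab p hp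
  rw [ratAff_comb p x y a b hab]
  have := hx p hp
  have := hy p hp
  positivity

lemma ratCell_closed {n : ℕ} (T : Finset (ℚ × (Fin n → ℚ))) : IsClosed (ratCell T) := by
  have : ratCell T = ⋂ p ∈ T, {x | 0 ≤ ratAff p x} := by ext x; simp [ratCell]
  rw [this]
  exact isClosed_biInter fun p _ => isClosed_le continuous_const (ratAff_continuous p)

lemma cube_compact (n : ℕ) : IsCompact (Cube n) := by
  have : Cube n = Set.Icc 0 1 := by
    ext x; simp [Cube, Pi.le_def, forall_and]
  rw [this]; exact isCompact_Icc

/-! ### Polytopes are hulls of finitely many rational points -/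

lemma extreme_unique {n : ℕ} (T : Finset (ℚ × (Fin n → ℚ))) (x : Fin n → ℝ)
    (hx : x ∈ (ratCell T).extremePoints ℝ) (y : Fin n → ℝ)
    (hy : ∀ p ∈ T, ratAff p x = 0 → ratAff p y = 0) : y = x := by
  rw [mem_extremePoints] at hx
  obtain ⟨hxQ, hext⟩ := hx
  have hev : ∀ᶠ s : ℝ in nhds 0, ∀ p ∈ T, 0 ≤ ratAff p ((1 - s) • x + s • y) := by
    rw [Filter.eventually_all_finset]
    intro p hp
    rcases (hxQ p hp).eq_or_lt with h0 | hpos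
    · refine Filter.Eventually.of_forall fun s => ?_
      rw [ratAff_comb p x y _ _ (by ring), hy p hp h0.symm, ← h0]; simp
    · have hc : Continuous fun s : ℝ => ratAff p ((1 - s) • x + s • y) :=
        (ratAff_continuous p).comp (by fun_prop)
      have h2 : ∀ᶠ s : ℝ in nhds 0, 0 < ratAff p ((1 - s) • x + s • y) :=
        (isOpen_lt continuous_const hc).mem_nhds (by simpa using hpos)
      exact h2.mono fun s hs => hs.le
  have hev2 : ∀ᶠ s : ℝ in nhds 0, ∀ p ∈ T, 0 ≤ ratAff p ((1 - (-s)) • x + (-s) • y) := by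
    have : Filter.Tendsto (fun s : ℝ => -s) (nhds 0) (nhds 0) := by
      simpa using (continuous_neg (G := ℝ)).tendsto 0
    exact this.eventually hev
  have hev3 := (hev.and hev2).filter_mono (nhdsWithin_le_nhds (s := Set.Ioi (0:ℝ)))
  obtain ⟨s, ⟨h1, h2⟩, hs⟩ := (hev3.and self_mem_nhdsWithin).exists
  have hs : 0 < s := hs
  have := (hext _ h1 _ h2 ⟨1/2, 1/2, by norm_num, by norm_num, by norm_num, by
    ext i; simp; ring⟩).1
  ext i
  have h3 := congrFun this i
  simp at h3
  have h4 : s * (y i - x i) = 0 := by linarith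
  rcases mul_eq_zero.1 h4 with h | h
  · exact absurd h hs.ne'
  · linarith

lemma extreme_rat {n : ℕ} (T : Finset (ℚ × (Fin n → ℚ))) (x : Fin n → ℝ)
    (hx : x ∈ (ratCell T).extremePoints ℝ) : HasRatCoords x := by
  obtain ⟨φ, hφ⟩ := LinearMap.exists_leftInverse_of_injective (Algebra.linearMap ℚ ℝ)
    (LinearMap.ker_eq_bot.2 (algebraMap ℚ ℝ).injective)
  have hφ1 : ∀ q : ℚ, φ (q : ℝ) = q := fun q => by
    have := LinearMap.congr_fun hφ q
    simpa using this
  have hy := extreme_unique T x hx (fun i => ((φ (x i) : ℚ) : ℝ)) (by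
    intro p _ h0
    rw [ratAff_ratCast]
    have h1 := congrArg φ h0
    have h2 : ∀ i, φ ((p.2 i : ℝ) * x i) = p.2 i * φ (x i) := fun i => by
      rw [← Rat.smul_def, map_smul, smul_eq_mul]
    simp only [ratAff, map_add, map_sum, hφ1, h2, map_zero] at h1
    rw [h1]; simp)
  intro i
  exact ⟨φ (x i), (congrFun hy i).symm⟩

lemma extreme_finite {n : ℕ} (T : Finset (ℚ × (Fin n → ℚ))) :
    ((ratCell T).extremePoints ℝ).Finite := by
  classical
  refine Set.Finite.of_injOn (f := fun x => T.filter fun p => ratAff p x = 0)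
    (t := (T.powerset : Set (Finset (ℚ × (Fin n → ℚ))))) ?_ ?_ (Finset.finite_toSet _)
  · intro x _
    exact Finset.mem_coe.2 (Finset.mem_powerset.2 (Finset.filter_subset _ _))
  · intro x hx y hy hxy
    refine extreme_unique T y hy x fun p hp h => ?_
    have : p ∈ T.filter fun p => ratAff p y = 0 := Finset.mem_filter.2 ⟨hp, h⟩
    simp only at hxy
    rw [← hxy] at this
    exact (Finset.mem_filter.1 this).2

lemma ratCell_eq_hull {n : ℕ} (T : Finset (ℚ × (Fin n → ℚ))) (hT : ratCell T ⊆ Cube n) :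
    ratCell T = convexHull ℝ ((ratCell T).extremePoints ℝ) := by
  have hc : IsCompact (ratCell T) := (cube_compact n).of_isClosed_subset (ratCell_closed T) hT
  have h := closure_convexHull_extremePoints hc (ratCell_convex T)
  rw [((extreme_finite T).isClosed_convexHull ℝ).closure_eq] at h
  exact h.symm

/-! ### Closure properties of rational polyhedra -/

lemma isRatPoly_of_finite {n : ℕ} (S : Set (Finset (Fin n → ℝ))) (hS : S.Finite)
    (h : ∀ V ∈ S, (∀ v ∈ V, HasRatCoords v) ∧
      AffineIndependent ℝ ((↑) : ((V : Set (Fin n → ℝ))) → (Fin n → ℝ))) :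
    IsRatPoly (⋃ V ∈ S, convexHull ℝ (V : Set (Fin n → ℝ))) := by
  have := hS.fintype
  refine ⟨Fintype.card S, fun j => ((Fintype.equivFin S).symm j : Finset (Fin n → ℝ)),
    fun j => h _ ((Fintype.equivFin S).symm j).2, ?_⟩
  rw [Set.biUnion_eq_iUnion]
  exact ((Fintype.equivFin S).symm.surjective.iUnion_comp
    (fun V : S => convexHull ℝ ((V : Finset (Fin n → ℝ)) : Set (Fin n → ℝ)))).symm

lemma isRatPoly_empty {n : ℕ} : IsRatPoly (∅ : Set (Fin n → ℝ)) := by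
  simpa using isRatPoly_of_finite (∅ : Set (Finset (Fin n → ℝ))) Set.finite_empty (by simp)

lemma isRatPoly_union {n : ℕ} {P Q : Set (Fin n → ℝ)} (hP : IsRatPoly P) (hQ : IsRatPoly Q) :
    IsRatPoly (P ∪ Q) := by
  obtain ⟨k, V, hV, rfl⟩ := hP
  obtain ⟨l, W, hW, rfl⟩ := hQ
  have := isRatPoly_of_finite (Set.range V ∪ Set.range W)
    ((Set.finite_range V).union (Set.finite_range W)) (by
      rintro _ (⟨j, rfl⟩ | ⟨j, rfl⟩)
      · exact hV j
      · exact hW j)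
  rwa [Set.biUnion_union, Set.biUnion_range, Set.biUnion_range] at this

lemma isRatPoly_sUnion {n : ℕ} (S : Set (Set (Fin n → ℝ))) (hS : S.Finite)
    (h : ∀ P ∈ S, IsRatPoly P) : IsRatPoly (⋃₀ S) := by
  induction S, hS using Set.Finite.induction_on with
  | empty => simpa using isRatPoly_empty
  | @insert a s _ _ ih =>
    rw [Set.sUnion_insert]
    exact isRatPoly_union (h a (by simp)) (ih fun P hP => h P (by simp [hP]))

lemma isRatPoly_ratCell {n : ℕ} (T : Finset (ℚ × (Fin n → ℚ))) (hT : ratCell T ⊆ Cube n) :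
    IsRatPoly (ratCell T) := by
  rw [ratCell_eq_hull T hT, convexHull_eq_union]
  have := isRatPoly_of_finite {t : Finset (Fin n → ℝ) |
      (t : Set (Fin n → ℝ)) ⊆ (ratCell T).extremePoints ℝ ∧
      AffineIndependent ℝ ((↑) : t → (Fin n → ℝ))} (by
      classical
      refine (Finset.finite_toSet (extreme_finite T).toFinset.powerset).subset ?_
      intro t ht
      rw [Finset.mem_coe, Finset.mem_powerset]
      intro v hv
      exact (extreme_finite T).mem_toFinset.2 (ht.1 hv)) (by
      rintro V ⟨hV, hA⟩
      exact ⟨fun v hv => extreme_rat T v (hV hv), hA⟩)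
  simpa only [Set.mem_ofPred_eq, Set.iUnion_and] using this

/-! ### Zerosets are rational polyhedra -/

lemma zero_on_cell {n : ℕ} (f : Cube n → ℝ) (hf : Continuous f) {k : ℕ}
    (l : Fin k → ℚ × (Fin n → ℚ)) (hl : ∀ x : Cube n, ∃ j, f x = ratAff (l j) x)
    (x y : Cube n) (hx : f x = 0)
    (h1 : ∀ j, 0 ≤ ratAff (l j) x → 0 ≤ ratAff (l j) y)
    (h2 : ∀ j, ratAff (l j) x ≤ 0 → ratAff (l j) y ≤ 0) : f y = 0 := by
  have hcv : Convex ℝ (Cube n) := by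
    intro u hu v hv a b ha hb hab i
    have := hu i
    have := hv i
    simp only [Pi.add_apply, Pi.smul_apply, smul_eq_mul]
    constructor
    · have := (hu i).1
      have := (hv i).1
      positivity
    · nlinarith [(hu i).2, (hv i).2]
  let γ : Set.Icc (0:ℝ) 1 → Cube n := fun t =>
    ⟨(1 - (t : ℝ)) • (x : Fin n → ℝ) + (t : ℝ) • (y : Fin n → ℝ),
      hcv x.2 y.2 (by linarith [t.2.2]) t.2.1 (by ring)⟩
  have hγ : Continuous γ := by
    refine Continuous.subtype_mk ?_ _
    fun_prop
  have hval : ∀ t j, ratAff (l j) (γ t) =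
      (1 - (t : ℝ)) * ratAff (l j) x + t * ratAff (l j) y :=
    fun t j => ratAff_comb _ _ _ _ _ (by ring)
  let A : Set (Set.Icc (0:ℝ) 1) := {t | f (γ t) = 0}
  let B : Set (Set.Icc (0:ℝ) 1) :=
    ⋃ j : {j // ratAff (l j) x ≠ 0}, {t | f (γ t) = ratAff (l j) (γ t)}
  have hA : IsClosed A := isClosed_eq (hf.comp hγ) continuous_const
  have hB : IsClosed B := isClosed_iUnion_of_finite fun j =>
    isClosed_eq (hf.comp hγ) ((ratAff_continuous _).comp (continuous_subtype_val.comp hγ))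
  have hγ0 : γ 0 = x := by ext i; simp [γ]
  have hγ1 : γ 1 = y := by ext i; simp [γ]
  have h01 : (0 : Set.Icc (0:ℝ) 1) < 1 := by
    rw [← Subtype.coe_lt_coe]; norm_num
  have hcover : Set.Iio (1 : Set.Icc (0:ℝ) 1) ⊆ A ∪ B := by
    intro t ht
    obtain ⟨j, hj⟩ := hl (γ t)
    by_cases h0 : ratAff (l j) x = 0
    · left
      have : ratAff (l j) y = 0 := le_antisymm (h2 j h0.le) (h1 j h0.ge)
      change f (γ t) = 0
      rw [hj, hval, h0, this]; simp
    · right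
      exact Set.mem_iUnion.2 ⟨⟨j, h0⟩, hj⟩
  have hsub : Set.Iio (1 : Set.Icc (0:ℝ) 1) ⊆ A := by
    intro t ht
    by_contra htA
    have htB : t ∈ B := (hcover ht).resolve_left htA
    obtain ⟨s, hs, hsA, hsB⟩ := isPreconnected_closed_iff.1 isPreconnected_Iio A B hA hB hcover
      ⟨0, h01, by change f (γ 0) = 0; rw [hγ0, hx]⟩ ⟨t, ht, htB⟩
    obtain ⟨⟨j, hj⟩, hsj⟩ := Set.mem_iUnion.1 hsB
    have hsA : f (γ s) = 0 := hsA
    have hsj : f (γ s) = ratAff (l j) (γ s) := hsj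
    rw [hsA, hval] at hsj
    have hs1 : (s : ℝ) < 1 := by
      have : s < 1 := hs
      rw [← Subtype.coe_lt_coe] at this
      simpa using this
    have hs0 := s.2.1
    rcases lt_or_gt_of_ne hj with hlt | hgt
    · have := h2 j hlt.le
      nlinarith [mul_pos (sub_pos.2 hs1) (neg_pos.2 hlt), mul_nonneg hs0 (neg_nonneg.2 this)]
    · have := h1 j hgt.le
      nlinarith [mul_pos (sub_pos.2 hs1) hgt, mul_nonneg hs0 this]
  have h1A : (1 : Set.Icc (0:ℝ) 1) ∈ A := by
    have := hA.closure_subset_iff.2 hsub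
    rw [closure_Iio' (a := (1 : Set.Icc (0:ℝ) 1)) ⟨0, h01⟩] at this
    exact this (Set.mem_Iic.2 le_rfl)
  have : f (γ 1) = 0 := h1A
  rwa [hγ1] at this

lemma zeroset_isRatPoly {n : ℕ} (f : Cube n → ℝ) (hf : IsPWLQ f) :
    IsRatPoly {y : Fin n → ℝ | ∃ x : Cube n, (x : Fin n → ℝ) = y ∧ f x = 0} := by
  classical
  obtain ⟨hc, -, k, c, a, hl⟩ := hf
  let l : Fin k → ℚ × (Fin n → ℚ) := fun j => (c j, a j)
  have hl' : ∀ x : Cube n, ∃ j, f x = ratAff (l j) x := hl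
  let C : Finset (ℚ × (Fin n → ℚ)) :=
    Finset.univ.image (fun i => ((0 : ℚ), (Pi.single i 1 : Fin n → ℚ))) ∪
    Finset.univ.image (fun i => ((1 : ℚ), (Pi.single i (-1) : Fin n → ℚ)))
  have hC : ∀ x : Fin n → ℝ, x ∈ Cube n ↔ ∀ p ∈ C, 0 ≤ ratAff p x := by
    intro x
    have e : ∀ (i : Fin n) (q : ℚ), ∑ j, ((Pi.single i q : Fin n → ℚ) j : ℝ) * x j = q * x i := by
      intro i q
      rw [Finset.sum_eq_single i]
      · simp
      · intro j _ hj; simp [Pi.single_eq_of_ne hj]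
      · simp
    simp only [C, Finset.mem_union, Finset.mem_image, Finset.mem_univ, true_and, or_imp,
      forall_and, forall_exists_index, forall_apply_eq_imp_iff, ratAff, e, Cube, Set.mem_ofPred_eq]
    simp
  let L : Finset (ℚ × (Fin n → ℚ)) := Finset.univ.image l ∪ Finset.univ.image (fun j => - l j) ∪ C
  let T : (Fin n → ℝ) → Finset (ℚ × (Fin n → ℚ)) := fun x => L.filter fun p => 0 ≤ ratAff p x
  let Z : Set (Fin n → ℝ) := {y : Fin n → ℝ | ∃ x : Cube n, (x : Fin n → ℝ) = y ∧ f x = 0}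
  have hsub : ∀ x ∈ Cube n, ratCell (T x) ⊆ Cube n := by
    intro x hx y hy
    refine (hC y).2 fun p hp => hy p (Finset.mem_filter.2 ⟨?_, (hC x).1 hx p hp⟩)
    exact Finset.mem_union_right _ hp
  have key : Z = ⋃₀ (ratCell '' (T '' Z)) := by
    apply Set.Subset.antisymm
    · intro x hx
      exact ⟨_, ⟨_, ⟨x, hx, rfl⟩, rfl⟩, fun p hp => (Finset.mem_filter.1 hp).2⟩
    · rintro y ⟨_, ⟨_, ⟨_, ⟨x, rfl, hx⟩, rfl⟩, rfl⟩, hy⟩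
      refine ⟨⟨y, hsub x x.2 hy⟩, rfl, zero_on_cell f hc l hl' x _ hx (fun j h => ?_) fun j h => ?_⟩
      · exact hy _ (Finset.mem_filter.2 ⟨by simp [L], h⟩)
      · have := hy (- l j) (Finset.mem_filter.2 ⟨by simp [L], by rw [ratAff_neg]; linarith⟩)
        rw [ratAff_neg] at this
        simpa using this
  change IsRatPoly Z
  rw [key]
  refine isRatPoly_sUnion _ (Set.Finite.image _ ?_) ?_
  · refine (Finset.finite_toSet L.powerset).subset ?_
    rintro _ ⟨x, _, rfl⟩
    exact Finset.mem_coe.2 (Finset.mem_powerset.2 (Finset.filter_subset _ _))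
  · rintro _ ⟨_, ⟨_, ⟨x, rfl, _⟩, rfl⟩, rfl⟩
    exact isRatPoly_ratCell _ (hsub x x.2)

/-! ### Simplexes are cut out by rational inequalities -/

lemma exists_coeffs {n : ℕ} (g : (Fin n → ℚ) →ᵃ[ℚ] ℚ) :
    ∃ p : ℚ × (Fin n → ℚ), ∀ q, g q = p.1 + ∑ i, p.2 i * q i := by
  refine ⟨(g 0, fun i => g.linear (Pi.single i 1)), fun q => ?_⟩
  have h1 : g q = g.linear q + g 0 := by
    have := congrFun (AffineMap.decomp g) q
    simpa using this
  rw [h1, LinearMap.pi_apply_eq_sum_univ g.linear q, add_comm]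
  congr 1
  refine Finset.sum_congr rfl fun i _ => ?_
  rw [smul_eq_mul, mul_comm]
  congr 2
  ext j
  simp [Pi.single_apply, eq_comm]

lemma simplex_eq_ratCell {n : ℕ} (V : Finset (Fin n → ℝ)) (hr : ∀ v ∈ V, HasRatCoords v)
    (hA : AffineIndependent ℝ ((↑) : ((V : Set (Fin n → ℝ))) → (Fin n → ℝ))) :
    ∃ T : Finset (ℚ × (Fin n → ℚ)), convexHull ℝ (V : Set (Fin n → ℝ)) = ratCell T := by
  classical
  let ι : (Fin n → ℚ) → (Fin n → ℝ) := fun q i => (q i : ℝ)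
  have hι : Function.Injective ι := fun p q h => by
    ext i; have := congrFun h i; simpa [ι] using this
  let W : Set (Fin n → ℚ) := {w | ι w ∈ V}
  have hW : AffineIndependent ℚ (fun p => p : W → (Fin n → ℚ)) := by
    let em : W ↪ (V : Set (Fin n → ℝ)) := ⟨fun w : W => ⟨ι w.1, w.2⟩, fun a b h => by
      apply Subtype.ext; apply hι; exact Subtype.mk.inj h⟩
    have h0 : AffineIndependent ℝ (fun w : W => ι w.1) := hA.comp_embedding em
    rw [affineIndependent_iff] at h0 ⊢
    intro s w hw hs e he
    have := h0 s (fun e => (w e : ℝ)) (by exact_mod_cast hw) (by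
      ext i
      have h1 := congrFun hs i
      simp only [Finset.sum_apply, Pi.smul_apply, smul_eq_mul, Pi.zero_apply, ι] at h1 ⊢
      exact_mod_cast h1) e he
    exact_mod_cast this
  obtain ⟨B, hWB, hB, htop⟩ := exists_subset_affineIndependent_affineSpan_eq_top hW
  have hBf : B.Finite := finite_set_of_fin_dim_affineIndependent ℚ hB
  have := hBf.fintype
  let b : AffineBasis B ℚ (Fin n → ℚ) := ⟨fun p => p, hB, by rw [Subtype.range_coe]; exact htop⟩
  have hb : ∀ i, b i = (i : Fin n → ℚ) := fun i => rfl
  choose P hP using fun i : B => exists_coeffs (b.coord i)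
  have hPι : ∀ i q, ratAff (P i) (ι q) = ((b.coord i q : ℚ) : ℝ) := fun i q => by
    rw [hP]; exact ratAff_ratCast _ _
  have hdense : DenseRange ι :=
    DenseRange.piMap (f := fun _ : Fin n => ((↑) : ℚ → ℝ)) fun _ => Rat.denseRange_cast
  have hsum : ∀ x, ∑ i, ratAff (P i) x = 1 := by
    refine congrFun (hdense.equalizer (g := fun x => ∑ i, ratAff (P i) x) (h := fun _ => 1)
      (continuous_finsetSum _ fun i _ => ratAff_continuous _) continuous_const ?_)
    ext q
    simp only [Function.comp_apply, hPι]
    exact_mod_cast b.sum_coord_apply_eq_one q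
  have hcomb : ∀ x, ∑ i, ratAff (P i) x • ι i = x := by
    refine congrFun (hdense.equalizer (g := fun x => ∑ i, ratAff (P i) x • ι i) (h := fun x => x)
      (continuous_finsetSum _ fun i _ => (ratAff_continuous _).smul continuous_const)
      continuous_id ?_)
    ext q j
    have h1 := congrFun (b.linear_combination_coord_eq_self q) j
    simp only [Function.comp_apply, hPι, Finset.sum_apply, Pi.smul_apply, smul_eq_mul, hb, ι]
      at h1 ⊢
    exact_mod_cast h1
  let N : Finset B := Finset.univ.filter fun i => (i : Fin n → ℚ) ∉ W
  refine ⟨Finset.univ.image P ∪ N.image (fun i => - P i), ?_⟩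
  apply Set.Subset.antisymm
  · refine convexHull_min ?_ (ratCell_convex _)
    intro v hv
    choose w hw using hr v hv
    have hvw : v = ι w := funext hw
    subst hvw
    have hwW : w ∈ W := hv
    have hco : ∀ i : B, b.coord i w = if i = ⟨w, hWB hwW⟩ then 1 else 0 := fun i =>
      b.coord_apply i ⟨w, hWB hwW⟩
    intro p hp
    rw [Finset.mem_union, Finset.mem_image, Finset.mem_image] at hp
    rcases hp with ⟨i, _, rfl⟩ | ⟨i, hi, rfl⟩
    · rw [hPι, hco]; split_ifs <;> simp
    · rw [ratAff_neg, hPι, hco, if_neg]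
      · simp
      · rintro rfl
        exact (Finset.mem_filter.1 hi).2 hwW
  · intro x hx
    have hpos : ∀ i, 0 ≤ ratAff (P i) x := fun i => hx _ (by simp)
    have hz : ∀ i : B, (i : Fin n → ℚ) ∉ W → ratAff (P i) x = 0 := fun i hi => by
      have := hx (- P i) (Finset.mem_union_right _ (Finset.mem_image_of_mem _ (by simp [N, hi])))
      rw [ratAff_neg] at this
      linarith [hpos i]
    let M : Finset B := Finset.univ.filter fun i => (i : Fin n → ℚ) ∈ W
    have hM : ∀ i : B, i ∉ M → ratAff (P i) x = 0 := fun i hi => hz i (by simpa [M] using hi)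
    rw [← hcomb x, ← Finset.sum_subset (Finset.subset_univ M)
      (fun i _ hi => by rw [hM i hi, zero_smul])]
    refine (convex_convexHull ℝ _).sum_mem (fun i _ => hpos i) ?_ fun i hi => ?_
    · rw [Finset.sum_subset (Finset.subset_univ M) (fun i _ hi => hM i hi), hsum]
    · exact subset_convexHull ℝ _ (Finset.mem_filter.1 hi).2

/-! ### Sets that are zerosets of integral piecewise linear functions -/

/-- `A` agrees on the cube with the zeroset of an integral piecewise linear function. -/
def IsZSet {n : ℕ} (A : Set (Fin n → ℝ)) : Prop :=
  ∃ g : Cube n → ℝ, Continuous g ∧ (∀ x, 0 ≤ g x ∧ g x ≤ 1) ∧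
    (∃ S : Finset (ℤ × (Fin n → ℤ)), ∀ x : Cube n, ∃ p ∈ S,
      g x = (p.1 : ℝ) + ∑ i, (p.2 i : ℝ) * (x : Fin n → ℝ) i) ∧
    ∀ x : Cube n, g x = 0 ↔ (x : Fin n → ℝ) ∈ A

lemma IsZSet.empty {n : ℕ} : IsZSet (∅ : Set (Fin n → ℝ)) :=
  ⟨fun _ => 1, continuous_const, fun _ => by norm_num, ⟨{(1, 0)}, fun x => ⟨(1, 0), by simp⟩⟩,
    fun x => by simp⟩

lemma IsZSet.univ {n : ℕ} : IsZSet (Set.univ : Set (Fin n → ℝ)) :=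
  ⟨fun _ => 0, continuous_const, fun _ => by norm_num, ⟨{(0, 0)}, fun x => ⟨(0, 0), by simp⟩⟩,
    fun x => by simp⟩

lemma IsZSet.union {n : ℕ} {A B : Set (Fin n → ℝ)} (hA : IsZSet A) (hB : IsZSet B) :
    IsZSet (A ∪ B) := by
  classical
  obtain ⟨g, gc, g01, ⟨S, hS⟩, hg⟩ := hA
  obtain ⟨h, hc, h01, ⟨R, hR⟩, hh⟩ := hB
  refine ⟨fun x => min (g x) (h x), gc.min hc, fun x => ⟨le_min (g01 x).1 (h01 x).1,
    (min_le_left _ _).trans (g01 x).2⟩, ⟨S ∪ R, fun x => ?_⟩, fun x => ?_⟩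
  · obtain ⟨p, hp, e⟩ := hS x
    obtain ⟨q, hq, e'⟩ := hR x
    rcases min_choice (g x) (h x) with h | h
    · exact ⟨p, Finset.mem_union_left _ hp, h.trans e⟩
    · exact ⟨q, Finset.mem_union_right _ hq, h.trans e'⟩
  · rw [Set.mem_union, ← hg, ← hh]
    have := (g01 x).1
    have := (h01 x).1
    constructor
    · intro h0
      rcases min_choice (g x) (h x) with h | h
      · left; rw [← h]; exact h0
      · right; rw [← h]; exact h0
    · rintro (h0 | h0)
      · simp [h0, *]
      · simp [h0, *]

lemma IsZSet.inter {n : ℕ} {A B : Set (Fin n → ℝ)} (hA : IsZSet A) (hB : IsZSet B) :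
    IsZSet (A ∩ B) := by
  classical
  obtain ⟨g, gc, g01, ⟨S, hS⟩, hg⟩ := hA
  obtain ⟨h, hc, h01, ⟨R, hR⟩, hh⟩ := hB
  refine ⟨fun x => max (g x) (h x), gc.max hc, fun x => ⟨(g01 x).1.trans (le_max_left _ _),
    max_le (g01 x).2 (h01 x).2⟩, ⟨S ∪ R, fun x => ?_⟩, fun x => ?_⟩
  · obtain ⟨p, hp, e⟩ := hS x
    obtain ⟨q, hq, e'⟩ := hR x
    rcases max_choice (g x) (h x) with h | h
    · exact ⟨p, Finset.mem_union_left _ hp, h.trans e⟩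
    · exact ⟨q, Finset.mem_union_right _ hq, h.trans e'⟩
  · rw [Set.mem_inter_iff, ← hg, ← hh]
    have h1 := (g01 x).1
    have h2 := (h01 x).1
    constructor
    · intro h0
      have := le_max_left (g x) (h x)
      have := le_max_right (g x) (h x)
      simp only at h0
      constructor <;> linarith
    · rintro ⟨h0, h0'⟩
      simp [h0, h0']

lemma exists_int_scale {n : ℕ} (p : ℚ × (Fin n → ℚ)) :
    ∃ (N : ℕ) (q : ℤ × (Fin n → ℤ)), 0 < N ∧ (q.1 : ℚ) = N * p.1 ∧
      ∀ i, (q.2 i : ℚ) = N * p.2 i := by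
  let N : ℕ := p.1.den * ∏ i, (p.2 i).den
  have key : ∀ r : ℚ, r.den ∣ N → ∃ z : ℤ, (z : ℚ) = N * r := by
    rintro r ⟨m, hm⟩
    refine ⟨m * r.num, ?_⟩
    rw [hm]
    push_cast
    rw [mul_comm (r.den : ℚ), mul_assoc, Rat.den_mul_eq_num]
  obtain ⟨z, hz⟩ := key p.1 (dvd_mul_right _ _)
  choose a ha using fun i => key (p.2 i)
    ((Finset.dvd_prod_of_mem (fun i => (p.2 i).den) (Finset.mem_univ i)).mul_left _)
  refine ⟨N, (z, a), ?_, hz, ha⟩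
  exact Nat.mul_pos p.1.den_pos (Finset.prod_pos fun i _ => (p.2 i).den_pos)

lemma IsZSet.halfspace {n : ℕ} (p : ℚ × (Fin n → ℚ)) : IsZSet {x | 0 ≤ ratAff p x} := by
  classical
  obtain ⟨N, q, hN, h1, h2⟩ := exists_int_scale (-p)
  have hq : ∀ x : Fin n → ℝ, (q.1 : ℝ) + ∑ i, (q.2 i : ℝ) * x i = N * (- ratAff p x) := by
    intro x
    rw [← ratAff_neg, ratAff, mul_add, Finset.mul_sum]
    have e1 : (q.1 : ℝ) = N * ((-p).1 : ℚ) := by exact_mod_cast congrArg (Rat.cast (K := ℝ)) h1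
    have e2 : ∀ i, (q.2 i : ℝ) = N * ((-p).2 i : ℚ) := fun i => by
      exact_mod_cast congrArg (Rat.cast (K := ℝ)) (h2 i)
    rw [e1]
    congr 1
    refine Finset.sum_congr rfl fun i _ => ?_
    rw [e2]; ring
  let u : Cube n → ℝ := fun x => N * (- ratAff p x)
  have hu : Continuous u :=
    continuous_const.mul ((ratAff_continuous p).comp continuous_subtype_val).neg
  refine ⟨fun x => min 1 (max 0 (u x)), continuous_const.min (continuous_const.max hu),
    fun x => ⟨le_min zero_le_one (le_max_left _ _), min_le_left _ _⟩,
    ⟨{(1, 0), (0, 0), q}, fun x => ?_⟩, fun x => ?_⟩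
  · rcases min_choice 1 (max 0 (u x)) with h | h
    · exact ⟨(1, 0), by simp, h.trans (by simp)⟩
    · rcases max_choice 0 (u x) with h' | h'
      · exact ⟨(0, 0), by simp, (h.trans h').trans (by simp)⟩
      · exact ⟨q, by simp, (h.trans h').trans (hq x).symm⟩
  · have hN' : (0:ℝ) < N := by exact_mod_cast hN
    have hiff : u x ≤ 0 ↔ 0 ≤ ratAff p x := by
      simp only [u]
      constructor
      · intro h; nlinarith
      · intro h; nlinarith
    rw [Set.mem_ofPred_eq, ← hiff]
    constructor
    · intro h
      rcases min_choice 1 (max 0 (u x)) with h' | h'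
      · simp only at h; rw [h'] at h; norm_num at h
      · simp only at h; rw [h'] at h
        exact (le_max_right _ _).trans h.le
    · intro h
      simp [max_eq_left h]

lemma IsZSet.ratCell {n : ℕ} (T : Finset (ℚ × (Fin n → ℚ))) : IsZSet (ratCell T) := by
  classical
  induction T using Finset.induction_on with
  | empty =>
    have : _root_.ratCell (∅ : Finset (ℚ × (Fin n → ℚ))) = Set.univ := by
      ext x; simp [_root_.ratCell]
    rw [this]; exact IsZSet.univ
  | insert p T _ ih =>
    have : _root_.ratCell (insert p T) = {x | 0 ≤ ratAff p x} ∩ _root_.ratCell T := by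
      ext x; simp [_root_.ratCell]
    rw [this]; exact (IsZSet.halfspace p).inter ih

lemma IsZSet.iUnion {n k : ℕ} (A : Fin k → Set (Fin n → ℝ)) (h : ∀ j, IsZSet (A j)) :
    IsZSet (⋃ j, A j) := by
  induction k with
  | zero => simpa using IsZSet.empty
  | succ k ih =>
    have : (⋃ j, A j) = A 0 ∪ ⋃ j : Fin k, A j.succ := by
      ext x; simp [Fin.exists_fin_succ]
    rw [this]
    exact (h 0).union (ih _ fun j => h _)

lemma IsZSet.exists_pwlz {n : ℕ} {A : Set (Fin n → ℝ)} (h : IsZSet A) :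
    ∃ f : Cube n → ℝ, IsPWLZ f ∧ IsPWLQ f ∧ ∀ x : Cube n, (f x = 0 ↔ (x : Fin n → ℝ) ∈ A) := by
  obtain ⟨g, gc, g01, ⟨S, hS⟩, hg⟩ := h
  have hZ : ∀ x : Cube n, ∃ j : Fin S.card, g x = ((S.equivFin.symm j).1.1 : ℝ) +
      ∑ i, ((S.equivFin.symm j).1.2 i : ℝ) * (x : Fin n → ℝ) i := by
    intro x
    obtain ⟨p, hp, e⟩ := hS x
    exact ⟨S.equivFin ⟨p, hp⟩, by simpa using e⟩
  refine ⟨g, ⟨gc, g01, S.card, fun j => (S.equivFin.symm j).1.1,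
    fun j => (S.equivFin.symm j).1.2, hZ⟩, ⟨gc, g01, S.card,
    fun j => ((S.equivFin.symm j).1.1 : ℚ), fun j i => ((S.equivFin.symm j).1.2 i : ℚ), ?_⟩, hg⟩
  intro x
  obtain ⟨j, hj⟩ := hZ x
  exact ⟨j, by simpa using hj⟩

/-- The zerosets of elements of `DMV_n` are exactly the rational
polyhedra contained in `[0,1]^n`: every rational polyhedron `P ⊆ [0,1]^n` is the
zeroset of some piecewise linear function with integer (hence rational) coefficients,
and conversely every `f ∈ DMV_n` has a rational polyhedron as its zeroset. -/
theorem zerosets_are_rational_polyhedra (n : ℕ) :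
    (∀ P : Set (Fin n → ℝ), P ⊆ Cube n → IsRatPoly P →
      ∃ f : Cube n → ℝ, IsPWLZ f ∧ IsPWLQ f ∧
        ∀ x : Cube n, (f x = 0 ↔ (x : Fin n → ℝ) ∈ P)) ∧
    (∀ f : Cube n → ℝ, IsPWLQ f →
      IsRatPoly {y : Fin n → ℝ | ∃ x : Cube n, (x : Fin n → ℝ) = y ∧ f x = 0}) := by
  refine ⟨?_, fun f hf => zeroset_isRatPoly f hf⟩
  rintro P - ⟨k, V, hV, rfl⟩
  refine IsZSet.exists_pwlz (IsZSet.iUnion _ fun j => ?_)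
  obtain ⟨T, hT⟩ := simplex_eq_ratCell (V j) (hV j).1 (hV j).2
  rw [hT]
  exact IsZSet.ratCell T
end
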